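/- Let Λ be a finite-dimensional algebra, Q a right Λ-module, A = End_Λ(Q), and n a natural number with n ≥ max(l, m + 2). Assume: (i) Ext^i_Λ(Q, Q) = 0 for 1 ≤ i ≤ n − 2; (ii) Q is an l-quasi-generator of mod-Λ; (iii) Q is an m-quasi-cogenerator of mod-Λ; (iv) the relative add(Q)-dimension of τ_{n−m−1}(Q) is at most m; (v) the relative add(Q)-codimension of τ⁻_i(Q) is finite for some 1 ≤ i ≤ n − 1. Then (A, Q) is a relative n-Auslander–Gorenstein pair; in particular A is an Iwanaga–Gorenstein algebra with id(_A A) = id(A_A) ≤ n and Q-domdim_A(A) ≥ n. -/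

import Mathlib

universe u
open MulOpposite

noncomputable section
namespace Paper

section RingDefs
variable (B : Type u) [Ring B]

/-- `X` belongs to `add Q`: it is a direct summand of a finite direct sum of copies of `Q`. -/
def InAdd (Q X : ModuleCat.{u} B) : Prop :=
  ∃ (n : ℕ) (s : X →ₗ[B] (Fin n → Q)) (r : (Fin n → Q) →ₗ[B] X), r ∘ₗ s = LinearMap.id

/-- A superfluous (small) submodule. -/
def Superfluous {P : ModuleCat.{u} B} (N : Submodule B P) : Prop :=
  ∀ K : Submodule B P, K ⊔ N = ⊤ → K = ⊤

/-- An essential (large) submodule. -/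
def Essential {P : ModuleCat.{u} B} (N : Submodule B P) : Prop :=
  ∀ K : Submodule B P, K ⊓ N = ⊥ → K = ⊥

/-- `p : P → X` is a projective cover. -/
def IsProjCover {P X : ModuleCat.{u} B} (p : P →ₗ[B] X) : Prop :=
  Module.Projective B P ∧ Function.Surjective p ∧ Superfluous B (LinearMap.ker p)

/-- `ι : X → I` is an injective envelope. -/
def IsInjEnvelope {X I : ModuleCat.{u} B} (ι : X →ₗ[B] I) : Prop :=
  Module.Injective B I ∧ Function.Injective ι ∧ Essential B (LinearMap.range ι)

/-- The zero module. -/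
def zeroMod : ModuleCat.{u} B := ModuleCat.of B PUnit

/-- An exact sequence `0 → P_m → ⋯ → P_1 → P_0 → X → 0` whose terms satisfy the
predicate `T` and which remains exact under `Hom(test, −)`. -/
def ResLE (test : ModuleCat.{u} B) (T : ModuleCat.{u} B → Prop)
    (X : ModuleCat.{u} B) (m : ℕ) : Prop :=
  ∃ (P : ℕ → ModuleCat.{u} B) (d : ∀ j, P (j+1) →ₗ[B] P j) (aug : P 0 →ₗ[B] X),
    (∀ j, j ≤ m → T (P j)) ∧ (∀ j, m < j → Subsingleton (P j)) ∧
    Function.Surjective aug ∧ Function.Exact (d 0) aug ∧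
    (∀ j, Function.Exact (d (j+1)) (d j)) ∧
    (∀ f : test →ₗ[B] X, ∃ h : test →ₗ[B] P 0, aug ∘ₗ h = f) ∧
    (∀ f : test →ₗ[B] P 0, aug ∘ₗ f = 0 → ∃ h : test →ₗ[B] P 1, d 0 ∘ₗ h = f) ∧
    (∀ j, ∀ f : test →ₗ[B] P (j+1), d j ∘ₗ f = 0 →
      ∃ h : test →ₗ[B] P (j+2), d (j+1) ∘ₗ h = f)

/-- An exact sequence `0 → X → I_0 → ⋯ → I_m → 0` whose terms satisfy the predicate `T`
and which remains exact under `Hom(−, test)`. -/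
def CoresLE (test : ModuleCat.{u} B) (T : ModuleCat.{u} B → Prop)
    (X : ModuleCat.{u} B) (m : ℕ) : Prop :=
  ∃ (M : ℕ → ModuleCat.{u} B) (ι : X →ₗ[B] M 0) (d : ∀ j, M j →ₗ[B] M (j+1)),
    (∀ j, j ≤ m → T (M j)) ∧ (∀ j, m < j → Subsingleton (M j)) ∧
    Function.Injective ι ∧ Function.Exact ι (d 0) ∧
    (∀ j, Function.Exact (d j) (d (j+1))) ∧
    (∀ f : X →ₗ[B] test, ∃ h : M 0 →ₗ[B] test, h ∘ₗ ι = f) ∧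
    (∀ f : M 0 →ₗ[B] test, f ∘ₗ ι = 0 → ∃ h : M 1 →ₗ[B] test, h ∘ₗ d 0 = f) ∧
    (∀ j, ∀ f : M (j+1) →ₗ[B] test, f ∘ₗ d j = 0 →
      ∃ h : M (j+2) →ₗ[B] test, h ∘ₗ d (j+1) = f)

/-- Projective dimension at most `n`. -/
def pdLE (X : ModuleCat.{u} B) (n : ℕ) : Prop :=
  ResLE B (zeroMod B) (fun P => Module.Projective B P) X n

/-- Injective dimension at most `n`. -/
def idLE (X : ModuleCat.{u} B) (n : ℕ) : Prop :=
  CoresLE B (zeroMod B) (fun I => Module.Injective B I) X n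

/-- Projective dimension equal to `n`. -/
def pdEq (X : ModuleCat.{u} B) (n : ℕ) : Prop :=
  pdLE B X n ∧ ∀ j, pdLE B X j → n ≤ j

/-- Injective dimension equal to `n`. -/
def idEq (X : ModuleCat.{u} B) (n : ℕ) : Prop :=
  idLE B X n ∧ ∀ j, idLE B X j → n ≤ j

/-- Projective dimension as an element of `ℕ∞`. -/
def pdDim (X : ModuleCat.{u} B) : ℕ∞ :=
  sInf {c : ℕ∞ | ∃ n : ℕ, c = n ∧ pdLE B X n}

/-- Injective dimension as an element of `ℕ∞`. -/
def idDim (X : ModuleCat.{u} B) : ℕ∞ :=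
  sInf {c : ℕ∞ | ∃ n : ℕ, c = n ∧ idLE B X n}

/-- Relative dominant dimension of `X` with respect to `Q` is at least `n`:
there is an exact sequence `0 → X → Q_1 → ⋯ → Q_n` with `Q_i ∈ add Q`
remaining exact under `Hom(−, Q)`. -/
def domdimGE (Q X : ModuleCat.{u} B) (n : ℕ) : Prop :=
  n = 0 ∨ ∃ (M : ℕ → ModuleCat.{u} B) (ι : X →ₗ[B] M 0) (d : ∀ j, M j →ₗ[B] M (j+1)),
    (∀ j, j + 1 ≤ n → InAdd B Q (M j)) ∧
    Function.Injective ι ∧ (2 ≤ n → Function.Exact ι (d 0)) ∧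
    (∀ j, j + 3 ≤ n → Function.Exact (d j) (d (j+1))) ∧
    (∀ f : X →ₗ[B] Q, ∃ h : M 0 →ₗ[B] Q, h ∘ₗ ι = f) ∧
    (2 ≤ n → ∀ f : M 0 →ₗ[B] Q, f ∘ₗ ι = 0 → ∃ h : M 1 →ₗ[B] Q, h ∘ₗ d 0 = f) ∧
    (∀ j, j + 3 ≤ n → ∀ f : M (j+1) →ₗ[B] Q, f ∘ₗ d j = 0 →
      ∃ h : M (j+2) →ₗ[B] Q, h ∘ₗ d (j+1) = f)

/-- Relative codominant dimension of `X` with respect to `Q` is at least `n`. -/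
def codomdimGE (Q X : ModuleCat.{u} B) (n : ℕ) : Prop :=
  n = 0 ∨ ∃ (M : ℕ → ModuleCat.{u} B) (aug : M 0 →ₗ[B] X) (d : ∀ j, M (j+1) →ₗ[B] M j),
    (∀ j, j + 1 ≤ n → InAdd B Q (M j)) ∧
    Function.Surjective aug ∧ (2 ≤ n → Function.Exact (d 0) aug) ∧
    (∀ j, j + 3 ≤ n → Function.Exact (d (j+1)) (d j)) ∧
    (∀ f : Q →ₗ[B] X, ∃ h : Q →ₗ[B] M 0, aug ∘ₗ h = f) ∧
    (2 ≤ n → ∀ f : Q →ₗ[B] M 0, aug ∘ₗ f = 0 → ∃ h : Q →ₗ[B] M 1, d 0 ∘ₗ h = f) ∧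
    (∀ j, j + 3 ≤ n → ∀ f : Q →ₗ[B] M (j+1), d j ∘ₗ f = 0 →
      ∃ h : Q →ₗ[B] M (j+2), d (j+1) ∘ₗ h = f)

/-- Relative dominant dimension with respect to `Q`, as an element of `ℕ∞`. -/
def relDomDim (Q X : ModuleCat.{u} B) : ℕ∞ :=
  sSup {c : ℕ∞ | ∃ n : ℕ, c = n ∧ domdimGE B Q X n}

/-- Relative codominant dimension with respect to `Q`, as an element of `ℕ∞`. -/
def relCodomDim (Q X : ModuleCat.{u} B) : ℕ∞ :=
  sSup {c : ℕ∞ | ∃ n : ℕ, c = n ∧ codomdimGE B Q X n}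

/-- A projective resolution. -/
structure ProjRes (X : ModuleCat.{u} B) where
  P : ℕ → ModuleCat.{u} B
  d : ∀ j, P (j+1) →ₗ[B] P j
  aug : P 0 →ₗ[B] X
  proj : ∀ j, Module.Projective B (P j)
  augSurj : Function.Surjective aug
  exact0 : Function.Exact (d 0) aug
  exact : ∀ j, Function.Exact (d (j+1)) (d j)

/-- Vanishing of `Ext^i(X, Y)`, expressed via projective resolutions. -/
def ExtVanish (X Y : ModuleCat.{u} B) : ℕ → Prop
  | 0 => Subsingleton (X →ₗ[B] Y)
  | (i+1) => ∀ R : ProjRes B X, ∀ f : R.P (i+1) →ₗ[B] Y,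
      f ∘ₗ R.d (i+1) = 0 → ∃ g : R.P i →ₗ[B] Y, f = g ∘ₗ R.d i

/-- `Q` is self-orthogonal: `Ext^i(Q, Q) = 0` for all `i > 0`. -/
def SelfOrth (Q : ModuleCat.{u} B) : Prop := ∀ i, 1 ≤ i → ExtVanish B Q Q i

/-- `Z` is a (first, minimal) syzygy of `X`. -/
def IsSyzygyOf (X Z : ModuleCat.{u} B) : Prop :=
  ∃ (P : ModuleCat.{u} B) (p : P →ₗ[B] X), IsProjCover B p ∧
    Nonempty (Z ≃ₗ[B] LinearMap.ker p)

/-- `Z` is an `n`-th syzygy `Ω^n X`. -/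
def IsOmegaOf : ℕ → ModuleCat.{u} B → ModuleCat.{u} B → Prop
  | 0, X, Z => Nonempty (Z ≃ₗ[B] X)
  | (n+1), X, Z => ∃ Y, IsSyzygyOf B X Y ∧ IsOmegaOf n Y Z

/-- `Z` is a (first, minimal) cosyzygy of `X`. -/
def IsCosyzygyOf (X Z : ModuleCat.{u} B) : Prop :=
  ∃ (I : ModuleCat.{u} B) (ι : X →ₗ[B] I), IsInjEnvelope B ι ∧
    Nonempty (Z ≃ₗ[B] (I ⧸ LinearMap.range ι))

/-- `Z` is an `n`-th cosyzygy `Ω^{-n} X`. -/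
def IsOmegaInvOf : ℕ → ModuleCat.{u} B → ModuleCat.{u} B → Prop
  | 0, X, Z => Nonempty (Z ≃ₗ[B] X)
  | (n+1), X, Z => ∃ Y, IsCosyzygyOf B X Y ∧ IsOmegaInvOf n Y Z

/-- Precomposition with `g`, as a map of right `B`-modules `Hom(P₀,B) → Hom(P₁,B)`. -/
def lprecomp {P1 P0 : ModuleCat.{u} B} (g : P1 →ₗ[B] P0) :
    (P0 →ₗ[B] B) →ₗ[Bᵐᵒᵖ] (P1 →ₗ[B] B) where
  toFun h := h ∘ₗ g
  map_add' _ _ := rfl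
  map_smul' _ _ := rfl

/-- `T` is a transpose `Tr X` (computed from a minimal projective presentation). -/
def IsTransposeOf (X : ModuleCat.{u} B) (T : ModuleCat.{u} Bᵐᵒᵖ) : Prop :=
  ∃ (P1 P0 : ModuleCat.{u} B) (g : P1 →ₗ[B] P0) (p : P0 →ₗ[B] X),
    IsProjCover B p ∧ Module.Projective B P1 ∧ Function.Exact g p ∧
    Superfluous B (LinearMap.ker g) ∧
    Nonempty (T ≃ₗ[Bᵐᵒᵖ] ((P1 →ₗ[B] B) ⧸ LinearMap.range (lprecomp B g)))

/-- The canonical ring homomorphism `B →+* Bᵐᵒᵖᵐᵒᵖ`. -/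
def opOpHom : B →+* Bᵐᵒᵖᵐᵒᵖ where
  toFun b := op (op b)
  map_one' := rfl
  map_mul' _ _ := rfl
  map_zero' := rfl
  map_add' _ _ := rfl


/-- An `F_Mo`-projective resolution: terms in `add(B ⊕ Mo)`, exact, and remaining
exact under `Hom(Mo, −)`. -/
structure FProjRes (Mo X : ModuleCat.{u} B) where
  P : ℕ → ModuleCat.{u} B
  d : ∀ j, P (j+1) →ₗ[B] P j
  aug : P 0 →ₗ[B] X
  mem : ∀ j, InAdd B (ModuleCat.of B (B × Mo)) (P j)
  augSurj : Function.Surjective aug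
  exact0 : Function.Exact (d 0) aug
  exact : ∀ j, Function.Exact (d (j+1)) (d j)
  lift0 : ∀ f : Mo →ₗ[B] X, ∃ h : Mo →ₗ[B] P 0, aug ∘ₗ h = f
  lift1 : ∀ f : Mo →ₗ[B] P 0, aug ∘ₗ f = 0 → ∃ h : Mo →ₗ[B] P 1, d 0 ∘ₗ h = f
  lift : ∀ j, ∀ f : Mo →ₗ[B] P (j+1), d j ∘ₗ f = 0 →
    ∃ h : Mo →ₗ[B] P (j+2), d (j+1) ∘ₗ h = f

/-- Vanishing of the relative extension group `Ext^i_{F_Mo}(X, Y)`, computed via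
`F_Mo`-projective resolutions. -/
def FExtVanish (Mo X Y : ModuleCat.{u} B) : ℕ → Prop
  | 0 => True
  | (i+1) => ∀ R : FProjRes B Mo X, ∀ f : R.P (i+1) →ₗ[B] Y,
      f ∘ₗ R.d (i+1) = 0 → ∃ g : R.P i →ₗ[B] Y, f = g ∘ₗ R.d i

end RingDefs

section Duality
variable (k : Type u) [Field k] (B : Type u) [Ring B] [Algebra k B]

noncomputable instance kmod (X : ModuleCat.{u} B) : Module k X :=
  Module.compHom X (algebraMap k B)

instance kmodSMulComm (X : ModuleCat.{u} B) : SMulCommClass B k X :=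
  ⟨fun b c x => by
    show b • ((algebraMap k B c) • x) = (algebraMap k B c) • (b • x)
    rw [← mul_smul, ← mul_smul, Algebra.commutes]⟩

instance kmodTower (X : ModuleCat.{u} B) : IsScalarTower k B X :=
  ⟨fun c b x => by
    show (c • b) • x = (algebraMap k B c) • (b • x)
    rw [Algebra.smul_def, mul_smul]⟩

noncomputable instance dualModL (X : ModuleCat.{u} B) : Module Bᵐᵒᵖ (X →ₗ[k] k) where
  smul b φ := φ ∘ₗ (DistribMulAction.toLinearMap k X b.unop)
  one_smul φ := by
    ext x
    show φ ((1 : Bᵐᵒᵖ).unop • x) = φ x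
    rw [unop_one, one_smul]
  mul_smul b c φ := by
    ext x
    show φ ((b * c).unop • x) = φ (c.unop • b.unop • x)
    rw [unop_mul, mul_smul]
  smul_zero b := rfl
  smul_add b φ ψ := rfl
  add_smul b c φ := by
    ext x
    show φ ((b + c).unop • x) = φ (b.unop • x) + φ (c.unop • x)
    rw [unop_add, add_smul, map_add]
  zero_smul φ := by
    ext x
    show φ ((0 : Bᵐᵒᵖ).unop • x) = 0
    rw [unop_zero, zero_smul, map_zero]

/-- The standard duality `D = Hom_k(−, k)`, sending a left `B`-module to a right
`B`-module. -/
def Dop (X : ModuleCat.{u} B) : ModuleCat.{u} Bᵐᵒᵖ :=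
  ModuleCat.of Bᵐᵒᵖ (X →ₗ[k] k)

noncomputable instance dualModR (Y : ModuleCat.{u} Bᵐᵒᵖ) : Module B (Y →ₗ[k] k) where
  smul b φ := φ ∘ₗ (DistribMulAction.toLinearMap k Y (op b))
  one_smul φ := by
    ext x
    show φ ((op (1:B)) • x) = φ x
    rw [op_one, one_smul]
  mul_smul b c φ := by
    ext x
    show φ ((op (b * c)) • x) = φ ((op c) • (op b) • x)
    rw [op_mul, mul_smul]
  smul_zero b := rfl
  smul_add b φ ψ := rfl
  add_smul b c φ := by
    ext x
    show φ ((op (b + c)) • x) = φ ((op b) • x) + φ ((op c) • x)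
    rw [op_add, add_smul, map_add]
  zero_smul φ := by
    ext x
    show φ ((op (0 : B)) • x) = 0
    rw [op_zero, zero_smul, map_zero]

/-- The standard duality `D = Hom_k(−, k)`, sending a right `B`-module to a left
`B`-module. -/
def Dunop (Y : ModuleCat.{u} Bᵐᵒᵖ) : ModuleCat.{u} B :=
  ModuleCat.of B (Y →ₗ[k] k)

/-- `D(B_B)`, the standard injective cogenerator of `B`-Mod. -/
def Dcogen : ModuleCat.{u} B := Dunop k B (ModuleCat.of Bᵐᵒᵖ B)

/-- `T ≅ τ X = D Tr X`, the Auslander–Reiten translate. -/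
def IsTauOf (X T : ModuleCat.{u} B) : Prop :=
  ∃ Tr : ModuleCat.{u} Bᵐᵒᵖ, IsTransposeOf B X Tr ∧ Nonempty (T ≃ₗ[B] Dunop k B Tr)

/-- `T ≅ τ_n X = τ Ω^{n-1} X`. -/
def IsTauN (n : ℕ) (X T : ModuleCat.{u} B) : Prop :=
  ∃ Z, IsOmegaOf B (n-1) X Z ∧ IsTauOf k B Z T

/-- `T ≅ τ⁻ X = Tr D X`, the inverse Auslander–Reiten translate. -/
def IsTauInvOf (X T : ModuleCat.{u} B) : Prop :=
  ∃ Tr2 : ModuleCat.{u} Bᵐᵒᵖᵐᵒᵖ, IsTransposeOf Bᵐᵒᵖ (Dop k B X) Tr2 ∧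
    Nonempty (T ≃ₗ[B] ((ModuleCat.restrictScalars (opOpHom B)).obj Tr2))

/-- `T ≅ τ⁻_n X = τ⁻ Ω^{-(n-1)} X`. -/
def IsTauInvN (n : ℕ) (X T : ModuleCat.{u} B) : Prop :=
  ∃ Z, IsOmegaInvOf B (n-1) X Z ∧ IsTauInvOf k B Z T

/-- The Nakayama functor `ν = D Hom_B(−, B)` (on objects). -/
def nu (X : ModuleCat.{u} B) : ModuleCat.{u} B :=
  Dunop k B (ModuleCat.of Bᵐᵒᵖ (X →ₗ[B] B))

/-- The inverse Nakayama functor `ν⁻ = Hom_B(D(−), B)` (on objects). -/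
def nuInv (X : ModuleCat.{u} B) : ModuleCat.{u} B :=
  (ModuleCat.restrictScalars (opOpHom B)).obj
    (ModuleCat.of Bᵐᵒᵖᵐᵒᵖ ((Dop k B X) →ₗ[Bᵐᵒᵖ] Bᵐᵒᵖ))

/-- Relative `add Q`-dimension of `X` is at most `m`. -/
def RelAddDimLE (Q X : ModuleCat.{u} B) (m : ℕ) : Prop :=
  ResLE B Q (InAdd B Q) X m

/-- Relative `add Q`-codimension of `X` is at most `m`. -/
def RelAddCodimLE (Q X : ModuleCat.{u} B) (m : ℕ) : Prop :=
  CoresLE B Q (InAdd B Q) X m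

/-- `Q` is an `l`-quasi-generator (without minimality of `l`). -/
def QuasiGenLE (Q : ModuleCat.{u} B) (l : ℕ) : Prop :=
  CoresLE B Q (InAdd B Q) (ModuleCat.of B B) l

/-- `Q` is an `l`-quasi-generator: `l` is minimal. -/
def IsQuasiGen (Q : ModuleCat.{u} B) (l : ℕ) : Prop :=
  QuasiGenLE B Q l ∧ ∀ j, QuasiGenLE B Q j → l ≤ j

/-- `Q` is an `m`-quasi-cogenerator (without minimality of `m`). -/
def QuasiCogenLE (Q : ModuleCat.{u} B) (m : ℕ) : Prop :=
  ResLE B Q (InAdd B Q) (Dcogen k B) m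

/-- `Q` is an `m`-quasi-cogenerator: `m` is minimal. -/
def IsQuasiCogen (Q : ModuleCat.{u} B) (m : ℕ) : Prop :=
  QuasiCogenLE k B Q m ∧ ∀ j, QuasiCogenLE k B Q j → m ≤ j

/-- `(B, Q)` is a relative `n`-Auslander–Gorenstein pair. -/
def IsRelAGPair (Q : ModuleCat.{u} B) (n : ℕ) : Prop :=
  idLE B (ModuleCat.of B B) n ∧ idLE Bᵐᵒᵖ (ModuleCat.of Bᵐᵒᵖ Bᵐᵒᵖ) n ∧
  SelfOrth B Q ∧ domdimGE B Q (ModuleCat.of B B) n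

/-- `Q` is an `(n, m, l)`-quasi-precluster tilting module. -/
def IsQPCT (Q : ModuleCat.{u} B) (n m l : ℕ) : Prop :=
  (∀ i, 1 ≤ i → i ≤ n - 2 → ExtVanish B Q Q i) ∧
  IsQuasiGen B Q l ∧
  IsQuasiCogen k B Q m ∧
  (∃ T, IsTauN k B (n - m - 1) Q T ∧ RelAddDimLE B Q T m) ∧
  (∃ T, IsTauInvN k B (n - l - 1) Q T ∧ RelAddCodimLE B Q T l)

/-- Precomposition with `g`, as a `k`-linear map between Hom spaces. -/
def pcompk {X Y Z : ModuleCat.{u} B} (g : X →ₗ[B] Y) :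
    (Y →ₗ[B] Z) →ₗ[k] (X →ₗ[B] Z) where
  toFun h := h ∘ₗ g
  map_add' _ _ := rfl
  map_smul' _ _ := rfl


/-- `I` is an injective object for the exact structure `F_Mo`: it lies in
`add(DB ⊕ τ Mo)`. -/
def IsFInj (Mo I : ModuleCat.{u} B) : Prop :=
  ∃ T, IsTauOf k B Mo T ∧ InAdd B (ModuleCat.of B ((Dcogen k B) × T)) I

/-- `T` is an `F_Mo`-cotilting object: finite relative injective dimension, no relative
self-extensions, and the relative injectives `DB ⊕ τ Mo` admit a finite `F_Mo`-exact
resolution by objects of `add T`. -/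
def FCotilting (Mo T : ModuleCat.{u} B) : Prop :=
  (∃ r, CoresLE B Mo (IsFInj k B Mo) T r) ∧
  (∀ i, 1 ≤ i → FExtVanish B Mo T T i) ∧
  (∃ τM, IsTauOf k B Mo τM ∧
    ∃ r, ResLE B Mo (InAdd B T) (ModuleCat.of B ((Dcogen k B) × τM)) r)

end Duality

section EndStuff
variable (A : Type u) [Ring A] (Q : ModuleCat.{u} A)

/-- The canonical ring homomorphism `A → End_{End_A(Q)}(Q)`. -/
def toEndE : A →+* Module.End (Module.End A Q) Q where
  toFun a :=
    { toFun := fun q => a • q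
      map_add' := fun x y => smul_add a x y
      map_smul' := fun e q => (e.map_smul a q).symm }
  map_one' := by ext q; exact one_smul A q
  map_mul' x y := by ext q; exact mul_smul x y q
  map_zero' := by ext q; exact zero_smul A q
  map_add' x y := by ext q; exact add_smul x y q

/-- `Hom_A(Q, X)` as a left module over `End_A(Q)ᵐᵒᵖ` (i.e. a left `Λ`-module) by
precomposition. -/
noncomputable instance homPrecompMod (X : ModuleCat.{u} A) :
    Module (Module.End A Q)ᵐᵒᵖ (Q →ₗ[A] X) where
  smul e f := f ∘ₗ e.unop
  one_smul f := by ext q; rfl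
  mul_smul e e' f := by ext q; rfl
  smul_zero e := rfl
  smul_add e f g := rfl
  add_smul e e' f := by ext q; exact map_add f _ _
  zero_smul f := by ext q; exact map_zero f

/-- The actions of `A` and of `End_A(Q)` on `Q` commute. -/
instance endSMulComm : SMulCommClass (Module.End A Q) A Q :=
  ⟨fun e a q => e.map_smul a q⟩

instance endSMulComm' : SMulCommClass A (Module.End A Q) Q :=
  ⟨fun a e q => (e.map_smul a q).symm⟩

end EndStuff

end Paper
end


namespace Sub12
open CategoryTheory Paper

section Homological
variable (R : Type) [Ring R]

/-- Projective dimension at most `n` (Ext based). -/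
abbrev PD (X : Type) [AddCommGroup X] [Module R X] (n : ℕ) : Prop :=
  HasProjectiveDimensionLE (ModuleCat.of R X) n

/-- Injective dimension at most `n` (Ext based). -/
abbrev ID (X : Type) [AddCommGroup X] [Module R X] (n : ℕ) : Prop :=
  HasInjectiveDimensionLE (ModuleCat.of R X) n

/-- Vanishing of Ext. -/
abbrev EV (X Y : Type) [AddCommGroup X] [Module R X] [AddCommGroup Y] [Module R Y] (n : ℕ) : Prop :=
  Subsingleton (Abelian.Ext (ModuleCat.of R X) (ModuleCat.of R Y) n)

variable {R}
variable {X Y Z W : Type} [AddCommGroup X] [Module R X] [AddCommGroup Y] [Module R Y]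
  [AddCommGroup Z] [Module R Z] [AddCommGroup W] [Module R W]

theorem ses (f : X →ₗ[R] Y) (g : Y →ₗ[R] Z) (hf : Function.Injective f)
    (hg : Function.Surjective g) (h : Function.Exact f g) :
    (ModuleCat.shortComplexOfCompEqZero f g h.linearMap_comp_eq_zero).ShortExact :=
  ModuleCat.shortComplex_shortExact _ h hf hg

theorem ID.mono {n m : ℕ} (h : ID R X n) (hnm : n ≤ m) : ID R X m :=
  hasInjectiveDimensionLT_of_ge _ (n+1) (m+1) (by omega)

theorem PD.mono {n m : ℕ} (h : PD R X n) (hnm : n ≤ m) : PD R X m :=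
  hasProjectiveDimensionLT_of_ge _ (n+1) (m+1) (by omega)

theorem ID.equiv {n : ℕ} (e : X ≃ₗ[R] Y) (h : ID R X n) : ID R Y n :=
  hasInjectiveDimensionLT_of_iso e.toModuleIso (n+1)

theorem PD.equiv {n : ℕ} (e : X ≃ₗ[R] Y) (h : PD R X n) : PD R Y n :=
  hasProjectiveDimensionLT_of_iso e.toModuleIso (n+1)

theorem PD.zero_iff : PD R X 0 ↔ Module.Projective R X := by
  rw [IsProjective.iff_projective]
  exact projective_iff_hasProjectiveDimensionLT_one.symm

theorem ID.zero_iff : ID R X 0 ↔ Module.Injective R X := by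
  rw [Module.injective_iff_injective_object]
  exact injective_iff_hasInjectiveDimensionLT_one.symm

theorem PD.of_proj (h : Module.Projective R X) (n : ℕ) : PD R X n :=
  (PD.zero_iff.2 h).mono (Nat.zero_le _)

theorem ID.of_inj (h : Module.Injective R X) (n : ℕ) : ID R X n :=
  (ID.zero_iff.2 h).mono (Nat.zero_le _)

theorem ID.left {n : ℕ} (f : X →ₗ[R] Y) (g : Y →ₗ[R] Z) (hf : Function.Injective f)
    (hg : Function.Surjective g) (h : Function.Exact f g) (hY : ID R Y (n+1)) (hZ : ID R Z n) :
    ID R X (n+1) :=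
  (ses f g hf hg h).hasInjectiveDimensionLT_X₁ (n+1) hZ hY

theorem ID.right {n : ℕ} (f : X →ₗ[R] Y) (g : Y →ₗ[R] Z) (hf : Function.Injective f)
    (hg : Function.Surjective g) (h : Function.Exact f g) (hY : ID R Y n) (hX : ID R X (n+1)) :
    ID R Z n :=
  (ses f g hf hg h).hasInjectiveDimensionLT_X₃ (n+1) hY hX

theorem ID.mid {n : ℕ} (f : X →ₗ[R] Y) (g : Y →ₗ[R] Z) (hf : Function.Injective f)
    (hg : Function.Surjective g) (h : Function.Exact f g) (hX : ID R X n) (hZ : ID R Z n) :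
    ID R Y n :=
  (ses f g hf hg h).hasInjectiveDimensionLT_X₂ (n+1) hX hZ

theorem PD.right {n : ℕ} (f : X →ₗ[R] Y) (g : Y →ₗ[R] Z) (hf : Function.Injective f)
    (hg : Function.Surjective g) (h : Function.Exact f g) (hY : PD R Y (n+1)) (hX : PD R X n) :
    PD R Z (n+1) :=
  (ses f g hf hg h).hasProjectiveDimensionLT_X₃ (n+1) hX hY

theorem PD.left {n : ℕ} (f : X →ₗ[R] Y) (g : Y →ₗ[R] Z) (hf : Function.Injective f)
    (hg : Function.Surjective g) (h : Function.Exact f g) (hY : PD R Y n) (hZ : PD R Z (n+1)) :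
    PD R X n :=
  (ses f g hf hg h).hasProjectiveDimensionLT_X₁ (n+1) hY hZ

/-- A four term exact sequence. -/
theorem ID.four {n : ℕ} (f : X →ₗ[R] Y) (g : Y →ₗ[R] Z) (h : Z →ₗ[R] W)
    (hf : Function.Injective f) (hh : Function.Surjective h) (hfg : Function.Exact f g)
    (hgh : Function.Exact g h) (hY : ID R Y n) (hZ : ID R Z n) (hW : ID R W n) :
    ID R X (n+2) := by
  have h1 : ID R (LinearMap.range g) (n+1) := by
    refine ID.left (LinearMap.range g).subtype h (Submodule.subtype_injective _) hh ?_
      (hZ.mono (by omega)) hW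
    intro z
    rw [hgh z]; simp
  refine ID.left f g.rangeRestrict hf g.surjective_rangeRestrict ?_ (hY.mono (by omega)) h1
  intro y
  rw [← hfg y]
  simp [Subtype.ext_iff]

theorem ID.retract {n : ℕ} (s : X →ₗ[R] Y) (r : Y →ₗ[R] X) (h : r ∘ₗ s = LinearMap.id)
    (hY : ID R Y n) : ID R X n := by
  let ρ : Retract (ModuleCat.of R X) (ModuleCat.of R Y) :=
    ⟨ModuleCat.ofHom s, ModuleCat.ofHom r, by
      rw [← ModuleCat.ofHom_comp, h]; rfl⟩
  exact ρ.hasInjectiveDimensionLT (n+1)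

theorem ID.pi {n : ℕ} (hY : ID R Y n) (m : ℕ) : ID R (Fin m → Y) n := by
  induction m with
  | zero =>
    apply ID.of_inj
    constructor
    intro A B _ _ _ _ f hf g
    exact ⟨0, fun x => Subsingleton.elim _ _⟩
  | succ m ih =>
    let e : (Y × (Fin m → Y)) ≃ₗ[R] (Fin (m+1) → Y) := Fin.consLinearEquiv R (fun _ => Y)
    refine ID.equiv e ?_
    exact ID.mid (LinearMap.inl R Y (Fin m → Y)) (LinearMap.snd R Y (Fin m → Y))
      LinearMap.inl_injective LinearMap.snd_surjective
      (Function.Exact.inl_snd) hY ih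

theorem ID.inAdd {n : ℕ} {Q M : ModuleCat.{0} R} (hQ : ID R Q n) (h : InAdd R Q M) : ID R M n := by
  obtain ⟨m, s, r, h⟩ := h
  exact ID.retract s r h (hQ.pi m)

theorem pd_of_seq (m : ℕ) : ∀ (X : Type) [AddCommGroup X] [Module R X] (P : ℕ → Type)
    [∀ j, AddCommGroup (P j)] [∀ j, Module R (P j)] (d : ∀ j, P (j+1) →ₗ[R] P j)
    (aug : P 0 →ₗ[R] X), (∀ j, j ≤ m → Module.Projective R (P j)) →
    (∀ j, m < j → Subsingleton (P j)) → Function.Surjective aug → Function.Exact (d 0) aug →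
    (∀ j, Function.Exact (d (j+1)) (d j)) → PD R X m := by
  induction m with
  | zero =>
    intro X _ _ P _ _ d aug hP hz hs h0 h
    have : Function.Injective aug := by
      rw [← LinearMap.ker_eq_bot, LinearMap.exact_iff.1 h0, LinearMap.range_eq_bot]
      have := hz 1 (by omega)
      ext x; rw [Subsingleton.elim x 0]; simp
    exact PD.equiv (LinearEquiv.ofBijective aug ⟨this, hs⟩) (PD.zero_iff.2 (hP 0 le_rfl))
  | succ m ih =>
    intro X _ _ P _ _ d aug hP hz hs h0 h
    refine PD.right (LinearMap.ker aug).subtype aug (Submodule.subtype_injective _) hs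
      aug.exact_subtype_ker_map (PD.of_proj (hP 0 (by omega)) _) ?_
    refine ih (LinearMap.ker aug) (fun j => P (j+1)) (fun j => d (j+1))
      ((d 0).codRestrict (LinearMap.ker aug) (fun x => (h0 _).2 ⟨x, rfl⟩))
      (fun j hj => hP _ (by omega)) (fun j hj => hz _ (by omega)) ?_ ?_ (fun j => h (j+1))
    · rintro ⟨x, hx⟩
      obtain ⟨y, hy⟩ := (h0 x).1 hx
      exact ⟨y, Subtype.ext hy⟩
    · intro x
      rw [← h 0 x, Subtype.ext_iff]; rfl

theorem id_of_seq (m : ℕ) : ∀ (X : Type) [AddCommGroup X] [Module R X] (P : ℕ → Type)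
    [∀ j, AddCommGroup (P j)] [∀ j, Module R (P j)] (ι : X →ₗ[R] P 0)
    (d : ∀ j, P j →ₗ[R] P (j+1)), (∀ j, j ≤ m → Module.Injective R (P j)) →
    (∀ j, m < j → Subsingleton (P j)) → Function.Injective ι → Function.Exact ι (d 0) →
    (∀ j, Function.Exact (d j) (d (j+1))) → ID R X m := by
  induction m with
  | zero =>
    intro X _ _ P _ _ ι d hP hz hs h0 h
    have : Function.Surjective ι := by
      intro x
      have := hz 1 (by omega)
      exact (h0 x).1 (Subsingleton.elim _ _)
    exact ID.equiv (LinearEquiv.ofBijective ι ⟨hs, this⟩).symm (ID.zero_iff.2 (hP 0 le_rfl))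
  | succ m ih =>
    intro X _ _ P _ _ ι d hP hz hs h0 h
    refine ID.left ι (LinearMap.range ι).mkQ hs (Submodule.mkQ_surjective _)
      ι.exact_map_mkQ_range (ID.of_inj (hP 0 (by omega)) _) ?_
    refine ih _ (fun j => P (j+1)) ((LinearMap.range ι).liftQ (d 0) ?_) (fun j => d (j+1))
      (fun j hj => hP _ (by omega)) (fun j hj => hz _ (by omega)) ?_ ?_ (fun j => h (j+1))
    · rintro _ ⟨x, rfl⟩
      exact (h0 _).2 ⟨x, rfl⟩
    · rw [← LinearMap.ker_eq_bot, Submodule.ker_liftQ, LinearMap.exact_iff.1 h0]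
      simp
    · rw [LinearMap.exact_iff, Submodule.range_liftQ, LinearMap.exact_iff.1 (h 0)]

theorem ID.of_idLE {X : ModuleCat.{0} R} {n : ℕ} (h : idLE R X n) : ID R X n := by
  obtain ⟨M, ι, d, h1, h2, h3, h4, h5, -⟩ := h
  exact id_of_seq n X (fun j => M j) ι d h1 h2 h3 h4 h5

instance : Subsingleton (zeroMod R) := inferInstanceAs (Subsingleton PUnit)

theorem idLE_mk {X : ModuleCat.{0} R} {n : ℕ} (M : ℕ → ModuleCat.{0} R) (ι : X →ₗ[R] M 0)
    (d : ∀ j, M j →ₗ[R] M (j+1)) (h1 : ∀ j, j ≤ n → Module.Injective R (M j))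
    (h2 : ∀ j, n < j → Subsingleton (M j)) (h3 : Function.Injective ι)
    (h4 : Function.Exact ι (d 0)) (h5 : ∀ j, Function.Exact (d j) (d (j+1))) : idLE R X n :=
  ⟨M, ι, d, h1, h2, h3, h4, h5, fun _ => ⟨0, LinearMap.ext fun _ => Subsingleton.elim _ _⟩,
    fun _ _ => ⟨0, LinearMap.ext fun _ => Subsingleton.elim _ _⟩,
    fun _ _ _ => ⟨0, LinearMap.ext fun _ => Subsingleton.elim _ _⟩⟩

theorem idLE_of_ID (n : ℕ) : ∀ (X : ModuleCat.{0} R), ID R X n → idLE R X n := by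
  induction n with
  | zero =>
    intro X h
    refine idLE_mk (fun j => Nat.casesOn j X (fun _ => zeroMod R)) LinearMap.id (fun _ => 0)
      ?_ ?_ ?_ ?_ ?_
    · intro j hj
      obtain rfl : j = 0 := by omega
      exact ID.zero_iff.1 h
    · intro j hj
      obtain ⟨j, rfl⟩ : ∃ i, j = i+1 := ⟨j-1, by omega⟩
      exact inferInstanceAs (Subsingleton (zeroMod R))
    · exact fun _ _ h => h
    · intro x; exact ⟨fun _ => ⟨x, rfl⟩, fun _ => rfl⟩
    · intro j x
      exact ⟨fun _ => ⟨0, @Subsingleton.elim (zeroMod R) _ _ _⟩, fun _ => rfl⟩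
  | succ n ih =>
    intro X h
    let ⟨I, hI, f, hf⟩ := EnoughInjectives.presentation X
    have injf : Function.Injective f.hom := (ModuleCat.mono_iff_injective f).mp ‹_›
    have hI' : Module.Injective R I := (Module.injective_iff_injective_object R I).2 hI
    have hC := ID.right f.hom (LinearMap.range f.hom).mkQ injf (Submodule.mkQ_surjective _)
      f.hom.exact_map_mkQ_range (ID.of_inj hI' n) h
    obtain ⟨M, ι, d, h1, h2, h3, h4, h5, -⟩ := ih (ModuleCat.of R (I ⧸ LinearMap.range f.hom)) hC
    refine idLE_mk (fun j => Nat.casesOn j I M) f.hom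
      (fun j => Nat.casesOn j (ι ∘ₗ (LinearMap.range f.hom).mkQ) d) ?_ ?_ injf ?_ ?_
    · rintro (_ | j) hj
      · exact hI'
      · exact h1 j (by omega)
    · rintro (_ | j) hj
      · omega
      · exact h2 j (by omega)
    · intro x
      refine Iff.trans ?_ (f.hom.exact_map_mkQ_range x)
      exact map_eq_zero_iff ι h3
    · rintro (_ | j)
      · intro x
        refine (h4 x).trans ?_
        constructor
        · rintro ⟨y, rfl⟩
          obtain ⟨z, rfl⟩ := Submodule.mkQ_surjective _ y
          exact ⟨z, rfl⟩
        · rintro ⟨z, rfl⟩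
          exact ⟨_, rfl⟩
      · exact h5 j

theorem idLE_iff {X : ModuleCat.{0} R} {n : ℕ} : idLE R X n ↔ ID R X n :=
  ⟨ID.of_idLE, idLE_of_ID n X⟩

/-! Ext groups -/

theorem ev_one_iff (f : X →ₗ[R] Y) (g : Y →ₗ[R] Z) (hf : Function.Injective f)
    (hg : Function.Surjective g) (h : Function.Exact f g) (hY : Module.Projective R Y) :
    EV R Z W 1 ↔ ∀ u : X →ₗ[R] W, ∃ v : Y →ₗ[R] W, v ∘ₗ f = u := by
  have S := ses f g hf hg h
  constructor
  · intro hE u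
    obtain ⟨x2, hx2⟩ := Abelian.Ext.contravariant_sequence_exact₁ S (ModuleCat.of R W)
      (Abelian.Ext.mk₀ (ModuleCat.ofHom u)) (add_zero 1) (Subsingleton.elim _ _)
    obtain ⟨v, rfl⟩ := Abelian.Ext.homEquiv₀.symm.surjective x2
    refine ⟨v.hom, ?_⟩
    have := hx2
    erw [Abelian.Ext.mk₀_comp_mk₀] at this
    have := Abelian.Ext.homEquiv₀.symm.injective this
    exact congrArg ModuleCat.Hom.hom this
  · intro hE
    refine ⟨fun a b => ?_⟩
    suffices ∀ a : Abelian.Ext (ModuleCat.of R Z) (ModuleCat.of R W) 1, a = 0 by rw [this a, this b]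
    intro a
    have : Projective (ModuleCat.of R Y) := inferInstance
    obtain ⟨x, rfl⟩ := Abelian.Ext.contravariant_sequence_exact₃ S (ModuleCat.of R W) a
      (Abelian.Ext.eq_zero_of_projective (P := ModuleCat.of R Y) _) (add_zero 1)
    obtain ⟨u, rfl⟩ := Abelian.Ext.homEquiv₀.symm.surjective x
    obtain ⟨v, hv⟩ := hE u.hom
    have hu : u = (ModuleCat.shortComplexOfCompEqZero f g h.linearMap_comp_eq_zero).f ≫
      ModuleCat.ofHom v := by
      ext1; exact hv.symm
    subst hu
    change S.extClass.comp (Abelian.Ext.mk₀ _) _ = 0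
    rw [← Abelian.Ext.mk₀_comp_mk₀]
    exact S.extClass_comp_assoc _

theorem ev_shift_iff (f : X →ₗ[R] Y) (g : Y →ₗ[R] Z) (hf : Function.Injective f)
    (hg : Function.Surjective g) (h : Function.Exact f g) (hY : Module.Projective R Y) (i : ℕ) :
    EV R Z W (i+2) ↔ EV R X W (i+1) := by
  have S := ses f g hf hg h
  have : Projective (ModuleCat.of R Y) := inferInstance
  constructor
  · intro hE
    refine ⟨fun a b => ?_⟩
    suffices ∀ a : Abelian.Ext (ModuleCat.of R X) (ModuleCat.of R W) (i+1), a = 0 by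
      rw [this a, this b]
    intro a
    obtain ⟨x, rfl⟩ := Abelian.Ext.contravariant_sequence_exact₁ S (ModuleCat.of R W) a
      (show 1 + (i+1) = i+2 by omega) (Subsingleton.elim _ _)
    rw [Abelian.Ext.eq_zero_of_projective (P := ModuleCat.of R Y) x]
    exact Abelian.Ext.comp_zero ..
  · intro hE
    refine ⟨fun a b => ?_⟩
    suffices ∀ a : Abelian.Ext (ModuleCat.of R Z) (ModuleCat.of R W) (i+2), a = 0 by
      rw [this a, this b]
    intro a
    obtain ⟨x, rfl⟩ := Abelian.Ext.contravariant_sequence_exact₃ S (ModuleCat.of R W) a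
      (Abelian.Ext.eq_zero_of_projective (P := ModuleCat.of R Y) _) (show 1 + (i+1) = i+2 by omega)
    rw [hE.elim x 0]
    exact Abelian.Ext.comp_zero ..

theorem ev_cov_one (f : X →ₗ[R] Y) (g : Y →ₗ[R] Z) (hf : Function.Injective f)
    (hg : Function.Surjective g) (h : Function.Exact f g)
    (hE : EV R W X 1) (u : W →ₗ[R] Z) : ∃ v : W →ₗ[R] Y, g ∘ₗ v = u := by
  have S := ses f g hf hg h
  obtain ⟨x2, hx2⟩ := Abelian.Ext.covariant_sequence_exact₃ (ModuleCat.of R W) S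
      (Abelian.Ext.mk₀ (ModuleCat.ofHom u)) (zero_add 1) (Subsingleton.elim _ _)
  obtain ⟨v, rfl⟩ := Abelian.Ext.homEquiv₀.symm.surjective x2
  refine ⟨v.hom, ?_⟩
  have := hx2
  erw [Abelian.Ext.mk₀_comp_mk₀] at this
  have := Abelian.Ext.homEquiv₀.symm.injective this
  exact congrArg ModuleCat.Hom.hom this

theorem ev_cov_shift (f : X →ₗ[R] Y) (g : Y →ₗ[R] Z) (hf : Function.Injective f)
    (hg : Function.Surjective g) (h : Function.Exact f g) (hY : Module.Injective R Y) (i : ℕ)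
    (hE : EV R W X (i+2)) : EV R W Z (i+1) := by
  have S := ses f g hf hg h
  have : Injective (ModuleCat.of R Y) := (Module.injective_iff_injective_object R Y).1 hY
  refine ⟨fun a b => ?_⟩
  suffices ∀ a : Abelian.Ext (ModuleCat.of R W) (ModuleCat.of R Z) (i+1), a = 0 by
    rw [this a, this b]
  intro a
  obtain ⟨x, rfl⟩ := Abelian.Ext.covariant_sequence_exact₃ (ModuleCat.of R W) S a
      (show (i+1) + 1 = i+2 by omega) (Subsingleton.elim _ _)
  rw [Abelian.Ext.eq_zero_of_injective (I := ModuleCat.of R Y) x]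
  exact Abelian.Ext.zero_comp ..

/-- The resolution shifted by one. -/
def shiftRes {X : ModuleCat.{0} R} (P : ProjRes R X) :
    ProjRes R (ModuleCat.of R (LinearMap.ker P.aug)) where
  P j := P.P (j+1)
  d j := P.d (j+1)
  aug := (P.d 0).codRestrict (LinearMap.ker P.aug) (fun x => (P.exact0 _).2 ⟨x, rfl⟩)
  proj j := P.proj (j+1)
  augSurj := by
    rintro ⟨x, hx⟩
    obtain ⟨y, hy⟩ := (P.exact0 x).1 hx
    exact ⟨y, Subtype.ext hy⟩
  exact0 := by
    intro x
    rw [← P.exact 0 x, Subtype.ext_iff]; rfl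
  exact j := P.exact (j+1)

theorem ev_iff_res (Y : ModuleCat.{0} R) (i : ℕ) : ∀ (X : ModuleCat.{0} R) (P : ProjRes R X),
    EV R X Y (i+1) ↔ ∀ f : P.P (i+1) →ₗ[R] Y, f ∘ₗ P.d (i+1) = 0 →
      ∃ g : P.P i →ₗ[R] Y, f = g ∘ₗ P.d i := by
  induction i with
  | zero =>
    intro X P
    rw [ev_one_iff (LinearMap.ker P.aug).subtype P.aug (Submodule.subtype_injective _) P.augSurj
      P.aug.exact_subtype_ker_map (P.proj 0)]
    have hq := (shiftRes P).augSurj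
    have he := (shiftRes P).exact0
    constructor
    · intro h f hf
      have hk : LinearMap.ker (shiftRes P).aug ≤ LinearMap.ker f := by
        intro x hx
        obtain ⟨y, rfl⟩ := (he x).1 hx
        exact LinearMap.congr_fun hf y
      let f' : LinearMap.ker P.aug →ₗ[R] Y :=
        ((LinearMap.ker (shiftRes P).aug).liftQ f hk) ∘ₗ
          ((shiftRes P).aug.quotKerEquivOfSurjective hq).symm.toLinearMap
      have hf' : ∀ x, f' ((shiftRes P).aug x) = f x := by
        intro x
        have : ((shiftRes P).aug.quotKerEquivOfSurjective hq).symm ((shiftRes P).aug x)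
          = (LinearMap.ker (shiftRes P).aug).mkQ x := by
          rw [LinearEquiv.symm_apply_eq]; rfl
        simp only [f', LinearMap.comp_apply, LinearEquiv.coe_coe, this]
        rfl
      obtain ⟨g, hg⟩ := h f'
      refine ⟨g, LinearMap.ext fun x => ?_⟩
      refine (hf' x).symm.trans ?_
      rw [← hg]; rfl
    · intro h u
      obtain ⟨g, hg⟩ := h (u ∘ₗ (shiftRes P).aug) (by
        ext x
        have : (shiftRes P).aug ((shiftRes P).d 0 x) = 0 := (he _).2 ⟨x, rfl⟩
        change u ((shiftRes P).aug ((shiftRes P).d 0 x)) = 0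
        rw [this, map_zero])
      refine ⟨g, LinearMap.ext fun x => ?_⟩
      obtain ⟨y, rfl⟩ := hq x
      exact (LinearMap.congr_fun hg y).symm
  | succ i ih =>
    intro X P
    rw [ev_shift_iff (LinearMap.ker P.aug).subtype P.aug (Submodule.subtype_injective _) P.augSurj
      P.aug.exact_subtype_ker_map (P.proj 0)]
    exact ih _ (shiftRes P)

theorem ID.ev {n i : ℕ} (h : ID R Y n) (hi : n < i) : EV R X Y i :=
  HasInjectiveDimensionLT.subsingleton _ (n+1) i hi _

end Homological
end Sub12


set_option linter.unusedSectionVars false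
set_option linter.style.haveILetI false
noncomputable section
namespace Sub12
open CategoryTheory Paper MulOpposite

section Dual
variable {k : Type} [Field k] {R S : Type} [Ring R] [Ring S] [Algebra k R] [Algebra k S]

/-- The `k`-dual of an `S`-module, an `R`-module for `R` anti-isomorphic to `S`. -/
def DD (_ : R ≃ₐ[k] Sᵐᵒᵖ) (X : Type) [AddCommGroup X] [Module k X] : Type := X →ₗ[k] k

/-- The inverse anti-isomorphism. -/
def flip (σ : R ≃ₐ[k] Sᵐᵒᵖ) : S ≃ₐ[k] Rᵐᵒᵖ := (AlgEquiv.opComm σ).symm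

theorem flip_apply (σ : R ≃ₐ[k] Sᵐᵒᵖ) (s : S) : (flip σ s).unop = σ.symm (op s) := rfl
theorem flip_apply' (σ : R ≃ₐ[k] Sᵐᵒᵖ) (r : R) : (flip σ (σ r).unop).unop = r := by
  rw [flip_apply]; simp
theorem apply_flip' (σ : R ≃ₐ[k] Sᵐᵒᵖ) (s : S) : (σ (flip σ s).unop).unop = s := by
  rw [flip_apply]; simp

variable (σ : R ≃ₐ[k] Sᵐᵒᵖ)
variable {X Y Z : Type} [AddCommGroup X] [Module k X] [AddCommGroup Y] [Module k Y]
  [AddCommGroup Z] [Module k Z]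

instance : AddCommGroup (DD σ X) := inferInstanceAs (AddCommGroup (X →ₗ[k] k))
instance : Module k (DD σ X) := inferInstanceAs (Module k (X →ₗ[k] k))
instance : FunLike (DD σ X) X k := inferInstanceAs (FunLike (X →ₗ[k] k) X k)
instance : LinearMapClass (DD σ X) k X k := inferInstanceAs (LinearMapClass (X →ₗ[k] k) k X k)
instance [FiniteDimensional k X] : FiniteDimensional k (DD σ X) :=
  inferInstanceAs (FiniteDimensional k (X →ₗ[k] k))

variable [Module S X] [IsScalarTower k S X] [Module S Y] [IsScalarTower k S Y]
  [Module S Z] [IsScalarTower k S Z]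

instance ddSMul : SMul R (DD σ X) :=
  ⟨fun r (φ : X →ₗ[k] k) => (φ ∘ₗ Algebra.lsmul k k X (σ r).unop : X →ₗ[k] k)⟩

theorem dd_ext {φ ψ : DD σ X} (h : ∀ x, φ x = ψ x) : φ = ψ := LinearMap.ext h
@[simp] theorem dd_smul (r : R) (φ : DD σ X) (x : X) : (r • φ) x = φ ((σ r).unop • x) := rfl
@[simp] theorem dd_add (φ ψ : DD σ X) (x : X) : (φ + ψ) x = φ x + ψ x := rfl
@[simp] theorem dd_zero (x : X) : (0 : DD σ X) x = 0 := rfl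
@[simp] theorem dd_ksmul (c : k) (φ : DD σ X) (x : X) : (c • φ) x = c * φ x := rfl

instance ddMod : Module R (DD σ X) where
  one_smul φ := dd_ext σ fun x => by simp
  mul_smul a b φ := dd_ext σ fun x => by simp [mul_smul]
  smul_zero a := dd_ext σ fun x => by simp
  smul_add a φ ψ := dd_ext σ fun x => by simp
  add_smul a b φ := dd_ext σ fun x => by simp [add_smul]
  zero_smul φ := dd_ext σ fun x => by simp

instance ddTower : IsScalarTower k R (DD σ X) :=
  ⟨fun c r φ => dd_ext σ fun x => by simp⟩

/-- The dual of a linear map. -/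
def dmap (f : X →ₗ[S] Y) : DD σ Y →ₗ[R] DD σ X where
  toFun φ := (φ : Y →ₗ[k] k) ∘ₗ f.restrictScalars k
  map_add' _ _ := rfl
  map_smul' r φ := dd_ext σ fun x => by
    change (r • φ) (f x) = φ (f ((σ r).unop • x))
    simp

@[simp] theorem dmap_apply (f : X →ₗ[S] Y) (φ : DD σ Y) (x : X) : dmap σ f φ x = φ (f x) := rfl

theorem dmap_inj (f : X →ₗ[S] Y) (hf : Function.Surjective f) : Function.Injective (dmap σ f) := by
  intro φ ψ h
  refine dd_ext σ fun y => ?_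
  obtain ⟨x, rfl⟩ := hf y
  exact DFunLike.congr_fun h x

theorem dmap_surj (f : X →ₗ[S] Y) (hf : Function.Injective f) : Function.Surjective (dmap σ f) := by
  intro φ
  obtain ⟨g, hg⟩ := LinearMap.exists_leftInverse_of_injective (f.restrictScalars k)
    (LinearMap.ker_eq_bot.2 hf)
  refine ⟨(φ : X →ₗ[k] k) ∘ₗ g, dd_ext σ fun x => ?_⟩
  exact congrArg φ (LinearMap.congr_fun hg x)

theorem dmap_exact (f : X →ₗ[S] Y) (g : Y →ₗ[S] Z) (hg : Function.Surjective g)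
    (h : Function.Exact f g) : Function.Exact (dmap σ g) (dmap σ f) := by
  intro φ
  constructor
  · intro hφ
    let g' := g.restrictScalars k
    have hg' : Function.Surjective g' := hg
    have hk : LinearMap.ker g' ≤ LinearMap.ker (φ : Y →ₗ[k] k) := by
      intro y hy
      obtain ⟨x, rfl⟩ := (h y).1 hy
      exact DFunLike.congr_fun hφ x
    refine ⟨((LinearMap.ker g').liftQ (φ : Y →ₗ[k] k) hk) ∘ₗ
      (g'.quotKerEquivOfSurjective hg').symm.toLinearMap, dd_ext σ fun y => ?_⟩
    have : (g'.quotKerEquivOfSurjective hg').symm (g' y) = (LinearMap.ker g').mkQ y := by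
      rw [LinearEquiv.symm_apply_eq]; rfl
    change ((LinearMap.ker g').liftQ (φ : Y →ₗ[k] k) hk)
      ((g'.quotKerEquivOfSurjective hg').symm (g' y)) = _
    rw [this]; rfl
  · rintro ⟨ψ, rfl⟩
    refine dd_ext σ fun x => ?_
    have : g (f x) = 0 := (h _).2 ⟨x, rfl⟩
    simp [this]

/-- Duals of projectives are injective. -/
theorem dd_injective (hX : Module.Projective S X) : Module.Injective R (DD σ X) := by
  constructor
  intro A B _ _ _ _ f hf g
  letI : Module k A := Module.compHom A (algebraMap k R)
  letI : Module k B := Module.compHom B (algebraMap k R)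
  haveI : IsScalarTower k R A := ⟨fun c r a => by
    change (c • r) • a = algebraMap k R c • r • a
    rw [Algebra.smul_def, mul_smul]⟩
  haveI : IsScalarTower k R B := ⟨fun c r a => by
    change (c • r) • a = algebraMap k R c • r • a
    rw [Algebra.smul_def, mul_smul]⟩
  have hgk : ∀ (c : k) a, g (c • a) = c • g a := by
    intro c a
    rw [← algebraMap_smul R c a, map_smul, algebraMap_smul]
  let g' : X →ₗ[S] DD (flip σ) A :=
    { toFun := fun x => 
        ({ toFun := fun a => g a x
           map_add' := fun a b => by simp
           map_smul' := fun c a => by simp [hgk] } : A →ₗ[k] k)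
      map_add' := fun x y => dd_ext _ fun a => map_add (g a) x y
      map_smul' := fun s x => dd_ext _ fun a => by
        change g a (s • x) = g ((flip σ s).unop • a) x
        rw [LinearMap.map_smul g, dd_smul, apply_flip'] }
  obtain ⟨h', hh'⟩ := Module.projective_lifting_property (dmap (flip σ) f) g'
    (dmap_surj (flip σ) f hf)
  refine ⟨{ toFun := fun b => 
              ({ toFun := fun x => h' x b
                 map_add' := fun x y => by simp
                 map_smul' := fun c x => by
                  rw [← algebraMap_smul S c x, map_smul, algebraMap_smul]; rfl } : X →ₗ[k] k)
            map_add' := fun a b => dd_ext _ fun x => map_add (h' x) a b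
            map_smul' := fun r b => dd_ext _ fun x => by
              change h' x (r • b) = h' ((σ r).unop • x) b
              rw [LinearMap.map_smul h', dd_smul, flip_apply'] }, fun a => dd_ext _ fun x => ?_⟩
  exact DFunLike.congr_fun (LinearMap.congr_fun hh' x) a

theorem id_dd (n : ℕ) : ∀ (X : Type) [AddCommGroup X] [Module k X] [Module S X]
    [IsScalarTower k S X], PD S X n → ID R (DD σ X) n := by
  induction n with
  | zero =>
    intro X _ _ _ _ h
    exact ID.of_inj (dd_injective σ (PD.zero_iff.1 h)) 0
  | succ n ih =>
    intro X _ _ _ _ h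
    let p : (X →₀ S) →ₗ[S] X := Finsupp.linearCombination S id
    have hp : Function.Surjective p := Finsupp.linearCombination_id_surjective S X
    have hK : PD S (LinearMap.ker p) n := PD.left (LinearMap.ker p).subtype p
      (Submodule.subtype_injective _) hp p.exact_subtype_ker_map (PD.of_proj inferInstance _) h
    exact ID.left (dmap σ p) (dmap σ (LinearMap.ker p).subtype) (dmap_inj σ _ hp)
      (dmap_surj σ _ (Submodule.subtype_injective _)) (dmap_exact σ _ _ hp p.exact_subtype_ker_map)
      (ID.of_inj (dd_injective σ inferInstance) _) (ih _ hK)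

/-- Biduality. -/
def evalDD [FiniteDimensional k X] : X ≃ₗ[S] DD (flip σ) (DD σ X) :=
  LinearEquiv.ofBijective
    ({ toFun := fun x => (Module.Dual.eval k X x : (X →ₗ[k] k) →ₗ[k] k)
       map_add' := fun x y => map_add (Module.Dual.eval k X) x y
       map_smul' := fun s x => dd_ext (X := DD σ X) (flip σ) fun (φ : DD σ X) => by
        change φ (s • x) = ((flip σ s).unop • φ : DD σ X) x
        rw [dd_smul, apply_flip'] } : X →ₗ[S] DD (flip σ) (DD σ X))
    (Module.evalEquiv k X).bijective

theorem evalDD_apply [FiniteDimensional k X] (x : X) (φ : DD σ X) : evalDD σ x φ = φ x := rfl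

theorem proj_of_dd_inj [FiniteDimensional k S] [FiniteDimensional k X]
    (h : Module.Injective R (DD σ X)) : Module.Projective S X := by
  haveI : Module.Finite S X := Module.Finite.of_restrictScalars_finite k S X
  obtain ⟨m, p, hp⟩ := Module.Finite.exists_fin' S X
  obtain ⟨ρ, hρ⟩ := h.out (dmap σ p) (dmap_inj σ p hp) LinearMap.id
  let s : X →ₗ[S] (Fin m → S) := (evalDD σ).symm.toLinearMap ∘ₗ dmap (flip σ) ρ ∘ₗ
    (evalDD σ (X := X)).toLinearMap
  have key : ∀ x (φ : DD σ (Fin m → S)), φ (s x) = ρ φ x := by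
    intro x φ
    rw [← evalDD_apply σ (s x) φ]
    simp only [s, LinearMap.comp_apply, LinearEquiv.coe_coe, LinearEquiv.apply_symm_apply]
    rfl
  refine Module.Projective.of_split s p (LinearMap.ext fun x => ?_)
  apply (evalDD σ).injective
  refine dd_ext _ fun φ => ?_
  rw [evalDD_apply, evalDD_apply]
  change dmap σ p φ (s x) = _
  rw [key, hρ]; rfl

theorem pd_of_id_dd [FiniteDimensional k S] (n : ℕ) : ∀ (X : Type) [AddCommGroup X] [Module k X]
    [Module S X] [IsScalarTower k S X] [FiniteDimensional k X], ID R (DD σ X) n → PD S X n := by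
  induction n with
  | zero =>
    intro X _ _ _ _ _ h
    exact PD.of_proj (proj_of_dd_inj σ (ID.zero_iff.1 h)) 0
  | succ n ih =>
    intro X _ _ _ _ _ h
    haveI : Module.Finite S X := Module.Finite.of_restrictScalars_finite k S X
    obtain ⟨m, p, hp⟩ := Module.Finite.exists_fin' S X
    have hK : ID R (DD σ (LinearMap.ker p)) n :=
      ID.right (dmap σ p) (dmap σ (LinearMap.ker p).subtype) (dmap_inj σ _ hp)
      (dmap_surj σ _ (Submodule.subtype_injective _)) (dmap_exact σ _ _ hp p.exact_subtype_ker_map)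
      (ID.of_inj (dd_injective σ inferInstance) _) h
    haveI : FiniteDimensional k (LinearMap.ker p) :=
      inferInstanceAs (FiniteDimensional k ((LinearMap.ker p).restrictScalars k))
    exact PD.right (LinearMap.ker p).subtype p
      (Submodule.subtype_injective _) hp p.exact_subtype_ker_map (PD.of_proj inferInstance _)
      (ih _ hK)

end Dual

section Zaks
variable {S : Type} [Ring S] [IsNoetherianRing S]

theorem proj_of_ev (n : ℕ) : ∀ (X : Type) [AddCommGroup X] [Module S X] [Module.Finite S X],
    PD S X n → (∀ i, EV S X S (i+1)) → Module.Projective S X := by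
  induction n with
  | zero => intro X _ _ _ h _; exact PD.zero_iff.1 h
  | succ n ih =>
    intro X _ _ _ h hE
    obtain ⟨m, p, hp⟩ := Module.Finite.exists_fin' S X
    have hK : PD S (LinearMap.ker p) n := PD.left (LinearMap.ker p).subtype p
      (Submodule.subtype_injective _) hp p.exact_subtype_ker_map (PD.of_proj inferInstance _) h
    have hKp := ih _ hK (fun i => (ev_shift_iff (LinearMap.ker p).subtype p
      (Submodule.subtype_injective _) hp p.exact_subtype_ker_map inferInstance i).1 (hE (i+1)))
    have h1 := (ev_one_iff (LinearMap.ker p).subtype p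
      (Submodule.subtype_injective _) hp p.exact_subtype_ker_map inferInstance).1 (hE 0)
    obtain ⟨t, q, hq⟩ := Module.Finite.exists_fin' S (LinearMap.ker p)
    obtain ⟨s, hs⟩ := Module.projective_lifting_property q LinearMap.id hq
    choose v hv using fun i : Fin t => h1 (LinearMap.proj i ∘ₗ s)
    let r : (Fin m → S) →ₗ[S] LinearMap.ker p := q ∘ₗ LinearMap.pi v
    have hr : ∀ x : LinearMap.ker p, r x = x := by
      intro x
      have : LinearMap.pi v (x : Fin m → S) = s x := by
        ext i
        exact LinearMap.congr_fun (hv i) x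
      change q (LinearMap.pi v (x : Fin m → S)) = x
      rw [this]; exact LinearMap.congr_fun hs x
    let w : (Fin m → S) →ₗ[S] (Fin m → S) := LinearMap.id - (LinearMap.ker p).subtype ∘ₗ r
    have hw : LinearMap.ker p ≤ LinearMap.ker w := by
      intro x hx
      have := hr ⟨x, hx⟩
      simp only [w, LinearMap.mem_ker, LinearMap.sub_apply, LinearMap.comp_apply]
      change x - (r x : Fin m → S) = 0
      rw [this, sub_self]
    refine Module.Projective.of_split ((LinearMap.ker p).liftQ w hw ∘ₗ
      (p.quotKerEquivOfSurjective hp).symm.toLinearMap) p (LinearMap.ext fun x => ?_)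
    obtain ⟨y, rfl⟩ := hp x
    have : (p.quotKerEquivOfSurjective hp).symm (p y) = (LinearMap.ker p).mkQ y := by
      rw [LinearEquiv.symm_apply_eq]; rfl
    simp only [LinearMap.comp_apply, LinearEquiv.coe_coe, this]
    change p (y - (r y : Fin m → S)) = p y
    rw [map_sub, (r y).2, sub_zero]

theorem pd_of_ev (n j : ℕ) : ∀ (X : Type) [AddCommGroup X] [Module S X] [Module.Finite S X],
    PD S X n → (∀ i, EV S X S (i+j+1)) → PD S X j := by
  induction j with
  | zero => intro X _ _ _ h hE; exact PD.of_proj (proj_of_ev n X h hE) 0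
  | succ j ih =>
    intro X _ _ _ h hE
    obtain ⟨m, p, hp⟩ := Module.Finite.exists_fin' S X
    have hK : PD S (LinearMap.ker p) n := PD.left (LinearMap.ker p).subtype p
      (Submodule.subtype_injective _) hp p.exact_subtype_ker_map (PD.of_proj inferInstance _)
      (h.mono (by omega))
    exact PD.right (LinearMap.ker p).subtype p
      (Submodule.subtype_injective _) hp p.exact_subtype_ker_map (PD.of_proj inferInstance _)
      (ih _ hK (fun i => (ev_shift_iff (LinearMap.ker p).subtype p
      (Submodule.subtype_injective _) hp p.exact_subtype_ker_map inferInstance (i+j)).1 (hE i)))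
end Zaks

theorem zaks {k : Type} [Field k] {R S : Type} [Ring R] [Ring S] [Algebra k R] [Algebra k S]
    [FiniteDimensional k R] [FiniteDimensional k S] (σ : R ≃ₐ[k] Sᵐᵒᵖ) {j r : ℕ}
    (hS : ID S S j) (hR : ID R R r) : ID R R j := by
  haveI : IsNoetherianRing S := isNoetherian_of_tower k inferInstance
  have h1 : ID R (DD σ (DD (flip σ) R)) r := ID.equiv (evalDD (flip σ)) hR
  have h2 : PD S (DD (flip σ) R) r := pd_of_id_dd σ r _ h1
  haveI : Module.Finite S (DD (flip σ) R) := Module.Finite.of_restrictScalars_finite k S _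
  have h3 : PD S (DD (flip σ) R) j := pd_of_ev r j _ h2 (fun i => hS.ev (by omega))
  exact ID.equiv (evalDD (flip σ)).symm (id_dd σ j _ h3)

end Sub12
end


set_option linter.unusedSectionVars false
set_option linter.unusedVariables false
set_option linter.style.haveILetI false
noncomputable section
namespace Sub12
open CategoryTheory Paper MulOpposite

/-! Retracts of finite powers -/
section Ret
variable {R : Type} [Ring R]

/-- Unbundled version of `InAdd`. -/
def Ret (R : Type) [Ring R] (N M : Type) [AddCommGroup N] [Module R N] [AddCommGroup M]
    [Module R M] : Prop :=
  ∃ (n : ℕ) (s : M →ₗ[R] (Fin n → N)) (r : (Fin n → N) →ₗ[R] M), r ∘ₗ s = LinearMap.id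

variable {N M L : Type} [AddCommGroup N] [Module R N] [AddCommGroup M] [Module R M]
  [AddCommGroup L] [Module R L]

theorem sum_sgl {n : ℕ} (x : Fin n → M) :
    ∑ i, LinearMap.single R (fun _ => M) i (x i) = x := by
  simp only [LinearMap.coe_single]
  exact Finset.univ_sum_single x

theorem Ret.refl : Ret R M M :=
  ⟨1, LinearMap.pi fun _ => LinearMap.id, LinearMap.proj 0, by ext x; simp⟩

theorem Ret.pow (n : ℕ) : Ret R M (Fin n → M) :=
  ⟨n, LinearMap.id, LinearMap.id, rfl⟩

theorem Ret.of_equiv_left (e : N ≃ₗ[R] L) (h : Ret R N M) : Ret R L M := by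
  obtain ⟨n, s, r, h⟩ := h
  let E : (Fin n → N) ≃ₗ[R] (Fin n → L) := LinearEquiv.piCongrRight fun _ => e
  refine ⟨n, E.toLinearMap ∘ₗ s, r ∘ₗ E.symm.toLinearMap, ?_⟩
  ext x
  have := LinearMap.congr_fun h x
  simpa using this

theorem Ret.proj (h : Ret R R M) : Module.Projective R M := by
  obtain ⟨n, s, r, h⟩ := h
  exact Module.Projective.of_split s r h

theorem Ret.id {n : ℕ} (h : Ret R N M) (hN : ID R N n) : ID R M n := by
  obtain ⟨m, s, r, h⟩ := h
  exact ID.retract s r h (hN.pi m)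

theorem Ret.of_proj (hM : Module.Projective R M) [Module.Finite R M] : Ret R R M := by
  obtain ⟨m, p, hp⟩ := Module.Finite.exists_fin' R M
  obtain ⟨s, hs⟩ := Module.projective_lifting_property p LinearMap.id hp
  exact ⟨m, s, p, hs⟩
end Ret

/-! The two hom functors -/
section FG
variable {B : Type} [Ring B] (Q : ModuleCat.{0} B)

/-- The endomorphism ring. -/
abbrev EE : Type := Module.End B Q

/-- `Hom(X, Q)`. -/
abbrev FF (X : Type) [AddCommGroup X] [Module B X] : Type := X →ₗ[B] Q

/-- `Hom(Q, X)`. -/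
def GG (X : Type) [AddCommGroup X] [Module B X] : Type := Q →ₗ[B] X

variable {X Y Z : Type} [AddCommGroup X] [Module B X] [AddCommGroup Y] [Module B Y]
  [AddCommGroup Z] [Module B Z]

instance : AddCommGroup (GG Q X) := inferInstanceAs (AddCommGroup (Q →ₗ[B] X))
instance : FunLike (GG Q X) Q X := inferInstanceAs (FunLike (Q →ₗ[B] X) Q X)
instance : LinearMapClass (GG Q X) B Q X := inferInstanceAs (LinearMapClass (Q →ₗ[B] X) B Q X)
instance : SMul (EE Q)ᵐᵒᵖ (GG Q X) := ⟨fun e (f : Q →ₗ[B] X) => (f ∘ₗ e.unop : Q →ₗ[B] X)⟩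

variable {Q}
theorem gg_ext {f g : GG Q X} (h : ∀ q, f q = g q) : f = g := LinearMap.ext h
@[simp] theorem gg_smul (e : (EE Q)ᵐᵒᵖ) (f : GG Q X) (q : Q) : (e • f) q = f (e.unop q) := rfl
@[simp] theorem gg_add (f g : GG Q X) (q : Q) : (f + g) q = f q + g q := rfl
@[simp] theorem gg_zero (q : Q) : (0 : GG Q X) q = 0 := rfl
variable (Q)

instance : Module (EE Q)ᵐᵒᵖ (GG Q X) where
  one_smul f := gg_ext fun q => by simp
  mul_smul e e' f := gg_ext fun q => by simp
  smul_zero e := gg_ext fun q => by simp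
  smul_add e f g := gg_ext fun q => by simp
  add_smul e e' f := gg_ext fun q => by simp
  zero_smul f := gg_ext fun q => by simp

/-- Functoriality of `FF`. -/
def fmap (g : X →ₗ[B] Y) : FF Q Y →ₗ[EE Q] FF Q X where
  toFun f := f ∘ₗ g
  map_add' _ _ := rfl
  map_smul' _ _ := rfl

/-- Functoriality of `GG`. -/
def gmap (g : X →ₗ[B] Y) : GG Q X →ₗ[(EE Q)ᵐᵒᵖ] GG Q Y where
  toFun f := g ∘ₗ (f : Q →ₗ[B] X)
  map_add' _ _ := gg_ext fun q => map_add g _ _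
  map_smul' _ _ := rfl

@[simp] theorem fmap_apply (g : X →ₗ[B] Y) (f : FF Q Y) : fmap Q g f = f ∘ₗ g := rfl
@[simp] theorem gmap_apply (g : X →ₗ[B] Y) (f : GG Q X) (q : Q) : gmap Q g f q = g (f q) := rfl

theorem fmap_inj (g : X →ₗ[B] Y) (hg : Function.Surjective g) : Function.Injective (fmap Q g) := by
  intro f f' h
  ext y
  obtain ⟨x, rfl⟩ := hg y
  exact LinearMap.congr_fun h x

theorem gmap_inj (g : X →ₗ[B] Y) (hg : Function.Injective g) : Function.Injective (gmap Q g) := by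
  intro f f' h
  refine gg_ext fun q => hg (DFunLike.congr_fun h q)

theorem fmap_exact (f : X →ₗ[B] Y) (g : Y →ₗ[B] Z) (hg : Function.Surjective g)
    (h : Function.Exact f g) : Function.Exact (fmap Q g) (fmap Q f) := by
  intro φ
  constructor
  · intro hφ
    have hk : LinearMap.ker g ≤ LinearMap.ker φ := by
      intro y hy
      obtain ⟨x, rfl⟩ := (h y).1 hy
      exact LinearMap.congr_fun hφ x
    refine ⟨((LinearMap.ker g).liftQ φ hk) ∘ₗ
      (g.quotKerEquivOfSurjective hg).symm.toLinearMap, LinearMap.ext fun y => ?_⟩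
    have : (g.quotKerEquivOfSurjective hg).symm (g y) = (LinearMap.ker g).mkQ y := by
      rw [LinearEquiv.symm_apply_eq]; rfl
    change ((LinearMap.ker g).liftQ φ hk) ((g.quotKerEquivOfSurjective hg).symm (g y)) = _
    rw [this]; rfl
  · rintro ⟨ψ, rfl⟩
    ext x
    have : g (f x) = 0 := (h _).2 ⟨x, rfl⟩
    simp [this]

theorem gmap_exact (f : X →ₗ[B] Y) (g : Y →ₗ[B] Z) (hf : Function.Injective f)
    (h : Function.Exact f g) : Function.Exact (gmap Q f) (gmap Q g) := by
  intro φ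
  constructor
  · intro hφ
    have hr : ∀ q, φ q ∈ LinearMap.range f := fun q => (h _).1 (DFunLike.congr_fun hφ q)
    let e := LinearEquiv.ofInjective f hf
    refine ⟨(e.symm.toLinearMap ∘ₗ LinearMap.codRestrict (LinearMap.range f)
      (φ : Q →ₗ[B] Y) hr : Q →ₗ[B] X), gg_ext fun q => ?_⟩
    change f (e.symm ⟨φ q, hr q⟩) = φ q
    have := congrArg Subtype.val (e.apply_symm_apply ⟨φ q, hr q⟩)
    exact this
  · rintro ⟨ψ, rfl⟩
    exact gg_ext fun q => (h _).2 ⟨ψ q, rfl⟩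

/-- `Hom(B, Q) = Q`. -/
def ffB : FF Q B ≃ₗ[EE Q] Q where
  toFun f := f 1
  map_add' _ _ := rfl
  map_smul' _ _ := rfl
  invFun q := LinearMap.toSpanSingleton B Q q
  left_inv f := by ext; simp
  right_inv q := by simp

/-- `Hom(Q, Q)` is the right regular module. -/
def ggQ : GG Q Q ≃ₗ[(EE Q)ᵐᵒᵖ] (EE Q)ᵐᵒᵖ where
  toFun f := op (f : Q →ₗ[B] Q)
  map_add' _ _ := rfl
  map_smul' _ _ := rfl
  invFun q := (q.unop : Q →ₗ[B] Q)
  left_inv f := rfl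
  right_inv q := rfl

theorem Ret.ff (h : Ret B X Y) : Ret (EE Q) (FF Q X) (FF Q Y) := by
  obtain ⟨n, s, r, h⟩ := h
  refine ⟨n, LinearMap.pi fun i => fmap Q (r ∘ₗ LinearMap.single B (fun _ => X) i),
    ∑ i, fmap Q (LinearMap.proj i ∘ₗ s) ∘ₗ LinearMap.proj i, ?_⟩
  ext f y
  have h' : r (s y) = y := LinearMap.congr_fun h y
  simp only [LinearMap.comp_apply, LinearMap.sum_apply, LinearMap.proj_apply, LinearMap.pi_apply,
    fmap_apply, LinearMap.id_apply]
  conv_rhs => rw [← h', ← sum_sgl (R := B) (s y)]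
  simp

theorem Ret.gg (h : Ret B X Y) : Ret (EE Q)ᵐᵒᵖ (GG Q X) (GG Q Y) := by
  obtain ⟨n, s, r, h⟩ := h
  refine ⟨n, LinearMap.pi fun i => gmap Q (LinearMap.proj i ∘ₗ s),
    ∑ i, gmap Q (r ∘ₗ LinearMap.single B (fun _ => X) i) ∘ₗ LinearMap.proj i, ?_⟩
  ext f
  refine gg_ext fun q => ?_
  have h' : r (s (f q)) = f q := LinearMap.congr_fun h (f q)
  have hsum : ∀ (g : Fin n → GG Q Y), (∑ i, g i) q = ∑ i, g i q := by
    intro g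
    exact LinearMap.sum_apply Finset.univ (fun i => (g i : Q →ₗ[B] Y)) q
  simp only [LinearMap.comp_apply, LinearMap.sum_apply, LinearMap.proj_apply, LinearMap.pi_apply,
    LinearMap.id_apply, hsum]
  conv_rhs => rw [← h', ← sum_sgl (R := B) (s (f q))]
  simp

/-- Reflexivity with respect to `Q`. -/
def Refl (X : Type) [AddCommGroup X] [Module B X] : Prop :=
  (∀ x : X, (∀ f : FF Q X, f x = 0) → x = 0) ∧
  ∀ φ : FF Q X →ₗ[EE Q] Q, ∃ x, ∀ f, φ f = f x

variable {Q}

theorem Refl.ret (h : Refl Q X) (hr : Ret B X Y) : Refl Q Y := by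
  obtain ⟨n, s, r, hrs⟩ := hr
  have h' : ∀ y, r (s y) = y := LinearMap.congr_fun hrs
  constructor
  · intro y hy
    rw [← h' y]
    have : s y = 0 := by
      ext i
      exact h.1 _ fun f => hy (f ∘ₗ LinearMap.proj i ∘ₗ s)
    rw [this, map_zero]
  · intro φ
    choose x hx using fun i => h.2 (φ ∘ₗ fmap Q (LinearMap.proj i ∘ₗ s))
    refine ⟨r x, fun f => ?_⟩
    have e1 : f = ∑ i, (f ∘ₗ r ∘ₗ LinearMap.single B (fun _ => X) i) ∘ₗ (LinearMap.proj i ∘ₗ s) := by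
      ext y
      conv_lhs => rw [← h' y, ← sum_sgl (R := B) (s y)]
      simp
    conv_lhs => rw [e1]
    rw [map_sum]
    conv_rhs => rw [← sum_sgl (R := B) x]
    rw [map_sum, map_sum]
    refine Finset.sum_congr rfl fun i _ => ?_
    exact hx i _

theorem Refl.self : Refl Q Q := by
  constructor
  · intro x h; exact h LinearMap.id
  · intro φ
    refine ⟨φ LinearMap.id, fun f => ?_⟩
    have := φ.map_smul (f : EE Q) (LinearMap.id : FF Q Q)
    rw [show (f : EE Q) • (LinearMap.id : FF Q Q) = f from rfl] at this
    exact this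

/-- Evaluation at an element. -/
def evAt (x : X) : FF Q X →ₗ[EE Q] Q where
  toFun f := f x
  map_add' _ _ := rfl
  map_smul' _ _ := rfl

@[simp] theorem evAt_apply (x : X) (f : FF Q X) : evAt x f = f x := rfl

theorem Refl.cores {X : ModuleCat.{0} B} {l : ℕ} (h : CoresLE B Q (InAdd B Q) X l) : Refl Q X := by
  obtain ⟨M, ι, d, h1, h2, h3, h4, h5, h6, h7, h8⟩ := h
  have hM : ∀ j, Refl Q (M j) := by
    intro j
    by_cases hj : j ≤ l
    · exact Refl.self.ret (h1 j hj)
    · haveI := h2 j (by omega)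
      refine ⟨fun x _ => Subsingleton.elim _ _, fun φ => ⟨0, fun f => ?_⟩⟩
      rw [show f = 0 from LinearMap.ext fun x => by rw [Subsingleton.elim x 0]; simp]
      simp
  constructor
  · intro x hx
    exact h3 (((hM 0).1 (ι x) fun f => hx (f ∘ₗ ι)).trans (map_zero ι).symm)
  · intro φ
    obtain ⟨x, hx⟩ := (hM 0).2 (φ ∘ₗ fmap Q ι)
    have hdx : d 0 x = 0 := (hM 1).1 _ fun f => by
      have e := hx (f ∘ₗ d 0)
      have e2 : fmap Q ι (f ∘ₗ d 0) = 0 := by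
        ext y
        have := (h4 (ι y)).2 ⟨y, rfl⟩
        simp [this]
      rw [LinearMap.comp_apply, e2, map_zero] at e
      exact e.symm
    obtain ⟨b, rfl⟩ := (h4 x).1 hdx
    refine ⟨b, fun f => ?_⟩
    obtain ⟨g, rfl⟩ := h6 f
    exact hx g

/-- Changing the resolved module. -/
def ProjRes.post {R : Type} [Ring R] {X Y : ModuleCat.{0} R} (P : ProjRes R X) (e : X ≃ₗ[R] Y) :
    ProjRes R Y where
  P := P.P
  d := P.d
  aug := e.toLinearMap ∘ₗ P.aug
  proj := P.proj
  augSurj := e.surjective.comp P.augSurj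
  exact0 := fun x => by
    rw [← P.exact0 x]
    simp
  exact := P.exact

theorem pd_of_cores {X : ModuleCat.{0} B} {l : ℕ} (h : CoresLE B Q (InAdd B Q) X l) :
    PD (EE Q) (FF Q X) l := by
  obtain ⟨M, ι, d, h1, h2, h3, h4, h5, h6, h7, h8⟩ := h
  refine pd_of_seq l _ (fun j => FF Q (M j)) (fun j => fmap Q (d j)) (fmap Q ι) ?_ ?_ h6 ?_ ?_
  · intro j hj
    exact Ret.proj (Ret.ff (X := Q) Q (h1 j hj))
  · intro j hj
    haveI := h2 j hj
    exact ⟨fun a b => LinearMap.ext fun x => by rw [Subsingleton.elim x 0]; simp⟩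
  · intro f
    refine ⟨fun hf => h7 f hf, ?_⟩
    rintro ⟨g, rfl⟩
    ext x
    have := (h4 (ι x)).2 ⟨x, rfl⟩
    simp [this]
  · intro j f
    refine ⟨fun hf => h8 j f hf, ?_⟩
    rintro ⟨g, rfl⟩
    ext x
    have := (h5 j (d j x)).2 ⟨x, rfl⟩
    simp [this]

theorem pd_of_res {X : ModuleCat.{0} B} {m : ℕ} (h : ResLE B Q (InAdd B Q) X m) :
    PD (EE Q)ᵐᵒᵖ (GG Q X) m := by
  obtain ⟨P, d, aug, h1, h2, h3, h4, h5, h6, h7, h8⟩ := h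
  refine pd_of_seq m _ (fun j => GG Q (P j)) (fun j => gmap Q (d j)) (gmap Q aug) ?_ ?_ ?_ ?_ ?_
  · intro j hj
    exact Ret.proj (Ret.of_equiv_left (ggQ Q) (Ret.gg (X := Q) Q (h1 j hj)))
  · intro j hj
    haveI := h2 j hj
    exact ⟨fun a b => gg_ext fun x => Subsingleton.elim _ _⟩
  · exact h6
  · intro f
    refine ⟨fun hf => h7 f hf, ?_⟩
    rintro ⟨g, rfl⟩
    exact gg_ext fun q => (h4 _).2 ⟨g q, rfl⟩
  · intro j f
    refine ⟨fun hf => h8 j f hf, ?_⟩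
    rintro ⟨g, rfl⟩
    exact gg_ext fun q => (h5 _ _).2 ⟨g q, rfl⟩

theorem selfOrth {l : ℕ} (h : QuasiGenLE B Q l) :
    SelfOrth (EE Q) (ModuleCat.of (EE Q) Q) := by
  obtain ⟨M, ι, d, h1, h2, h3, h4, h5, h6, h7, h8⟩ := h
  have hM : ∀ j, Refl Q (M j) := by
    intro j
    by_cases hj : j ≤ l
    · exact Refl.self.ret (h1 j hj)
    · haveI := h2 j (by omega)
      refine ⟨fun x _ => Subsingleton.elim _ _, fun φ => ⟨0, fun f => ?_⟩⟩
      rw [show f = 0 from LinearMap.ext fun x => by rw [Subsingleton.elim x 0]; simp]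
      simp
  let P : ProjRes (EE Q) (ModuleCat.of (EE Q) (FF Q B)) :=
    { P := fun j => ModuleCat.of (EE Q) (FF Q (M j))
      d := fun j => fmap Q (d j)
      aug := fmap Q ι
      proj := fun j => by
        by_cases hj : j ≤ l
        · exact Ret.proj (Ret.ff (X := Q) Q (h1 j hj))
        · haveI := h2 j (by omega)
          haveI : Subsingleton (FF Q (M j)) :=
            ⟨fun a b => LinearMap.ext fun x => by rw [Subsingleton.elim x 0]; simp⟩
          exact inferInstanceAs (Module.Projective (EE Q) (FF Q (M j)))
      augSurj := h6
      exact0 := fun f => by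
        refine ⟨fun hf => h7 f hf, ?_⟩
        rintro ⟨g, rfl⟩
        refine LinearMap.ext fun x => ?_
        have := (h4 (ι x)).2 ⟨x, rfl⟩
        change g (d 0 (ι x)) = 0
        simp [this]
      exact := fun j f => by
        refine ⟨fun hf => h8 j f hf, ?_⟩
        rintro ⟨g, rfl⟩
        refine LinearMap.ext fun x => ?_
        have := (h5 j (d j x)).2 ⟨x, rfl⟩
        change g (d (j+1) (d j x)) = 0
        simp [this] }
  let P' : ProjRes (EE Q) (ModuleCat.of (EE Q) Q) := ProjRes.post P (ffB Q)
  intro i hi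
  obtain ⟨i, rfl⟩ : ∃ i', i = i' + 1 := ⟨i - 1, by omega⟩
  intro R
  refine (ev_iff_res _ i _ R).1 ((ev_iff_res _ i _ P').2 ?_)
  intro (f : FF Q (M (i+1)) →ₗ[EE Q] Q) hf
  obtain ⟨x, hx⟩ := (hM (i+1)).2 f
  have hdx : d (i+1) x = 0 := (hM (i+2)).1 _ fun g => by
    have e := hx (g ∘ₗ d (i+1))
    exact e.symm.trans (LinearMap.congr_fun hf g)
  obtain ⟨y, rfl⟩ := (h5 _ x).1 hdx
  exact ⟨evAt y, LinearMap.ext fun g => hx g⟩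

end FG
end Sub12
end


set_option linter.unusedSectionVars false
set_option linter.unusedVariables false
set_option linter.style.haveILetI false
noncomputable section
namespace Sub12
open CategoryTheory Paper MulOpposite

section FreeRes
variable {B : Type} [Ring B] [IsNoetherianRing B]

/-- Finitely generated modules. -/
structure FgMod (B : Type) [Ring B] where
  /-- carrier -/
  M : ModuleCat.{0} B
  fin : Module.Finite B M

/-- Number of generators. -/
def FgMod.rk (X : FgMod B) : ℕ := haveI := X.fin; (Module.Finite.exists_fin' B X.M).choose

/-- A free cover. -/
def FgMod.cov (X : FgMod B) : (Fin X.rk → B) →ₗ[B] X.M :=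
  haveI := X.fin; (Module.Finite.exists_fin' B X.M).choose_spec.choose

theorem FgMod.cov_surj (X : FgMod B) : Function.Surjective X.cov :=
  haveI := X.fin; (Module.Finite.exists_fin' B X.M).choose_spec.choose_spec

/-- Syzygy. -/
def FgMod.syz (X : FgMod B) : FgMod B where
  M := ModuleCat.of B (LinearMap.ker X.cov)
  fin := inferInstanceAs (Module.Finite B (LinearMap.ker X.cov))

/-- Iterated syzygy. -/
def FgMod.sy (X : FgMod B) : ℕ → FgMod B
  | 0 => X
  | j+1 => (X.sy j).syz

/-- The canonical map from a syzygy. -/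
def FgMod.inc (X : FgMod B) : X.syz.M →ₗ[B] (Fin X.rk → B) := (LinearMap.ker X.cov).subtype

theorem FgMod.inc_inj (X : FgMod B) : Function.Injective X.inc := Submodule.subtype_injective _
theorem FgMod.inc_exact (X : FgMod B) : Function.Exact X.inc X.cov := X.cov.exact_subtype_ker_map

/-- A resolution by finite free modules. -/
def FgMod.res (X : FgMod B) : ProjRes B X.M where
  P j := ModuleCat.of B (Fin (X.sy j).rk → B)
  d j := (X.sy j).inc ∘ₗ (X.sy (j+1)).cov
  aug := X.cov
  proj j := inferInstanceAs (Module.Projective B (Fin (X.sy j).rk → B))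
  augSurj := X.cov_surj
  exact0 x := by
    refine (X.inc_exact x).trans ?_
    constructor
    · rintro ⟨y, rfl⟩
      obtain ⟨z, rfl⟩ := (X.sy 1).cov_surj y
      exact ⟨z, rfl⟩
    · rintro ⟨y, rfl⟩
      exact ⟨(X.sy 1).cov y, rfl⟩
  exact j x := by
    have : (X.sy (j+1)).cov x = 0 ↔ ((X.sy j).inc ∘ₗ (X.sy (j+1)).cov) x = 0 := by
      exact (map_eq_zero_iff (X.sy j).inc (X.sy j).inc_inj).symm
    refine this.symm.trans ?_
    refine ((X.sy (j+1)).inc_exact x).trans ?_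
    constructor
    · rintro ⟨y, rfl⟩
      obtain ⟨z, rfl⟩ := (X.sy (j+2)).cov_surj y
      exact ⟨z, rfl⟩
    · rintro ⟨y, rfl⟩
      exact ⟨(X.sy (j+2)).cov y, rfl⟩

variable {Q : ModuleCat.{0} B} [Module.Finite B Q]

theorem ev_of_vanish (n : ℕ) (h1 : ∀ i, 1 ≤ i → i ≤ n → ExtVanish B Q Q i) (i : ℕ) (hi : 1 ≤ i)
    (hin : i ≤ n) : EV B Q Q i := by
  obtain ⟨i, rfl⟩ : ∃ i', i = i' + 1 := ⟨i - 1, by omega⟩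
  let X : FgMod B := ⟨Q, inferInstance⟩
  exact (ev_iff_res Q i Q X.res).2 (h1 _ hi hin X.res)

theorem domdim {n : ℕ} (h1 : ∀ i, 1 ≤ i → i ≤ n - 2 → ExtVanish B Q Q i) (hB : Refl Q B) :
    domdimGE (EE Q) (ModuleCat.of (EE Q) Q) (ModuleCat.of (EE Q) (EE Q)) n := by
  right
  let X : FgMod B := ⟨Q, inferInstance⟩
  let P := X.res
  have hR : ∀ j, Refl Q (P.P j) := fun j => hB.ret (Ret.pow _)
  refine ⟨fun j => ModuleCat.of (EE Q) (FF Q (P.P j)), fmap Q P.aug, fun j => fmap Q (P.d j),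
    ?_, ?_, ?_, ?_, ?_, ?_, ?_⟩
  · intro j _
    exact Ret.of_equiv_left (ffB Q) (Ret.ff Q (Ret.pow _))
  · exact fmap_inj Q P.aug P.augSurj
  · intro _
    exact fmap_exact Q (P.d 0) P.aug P.augSurj P.exact0
  · intro j hj f
    constructor
    · intro hf
      obtain ⟨g, hg⟩ := h1 (j+1) (by omega) (by omega) P f hf
      exact ⟨g, hg.symm⟩
    · rintro ⟨g, rfl⟩
      refine LinearMap.ext fun x => ?_
      have := (P.exact j _).2 ⟨x, rfl⟩
      change g (P.d j (P.d (j+1) x)) = 0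
      rw [this]; exact map_zero (g : P.P j →ₗ[B] Q)
  · intro (f : FF Q Q →ₗ[EE Q] Q)
    obtain ⟨q, hq⟩ := Refl.self.2 f
    obtain ⟨p, rfl⟩ := P.augSurj q
    exact ⟨evAt p, LinearMap.ext fun a => (hq a).symm⟩
  · intro _ (f : FF Q (P.P 0) →ₗ[EE Q] Q) hf
    obtain ⟨p, hp⟩ := (hR 0).2 f
    have : P.aug p = 0 := by
      have e := hp P.aug
      exact e.symm.trans (LinearMap.congr_fun hf (1 : EE Q))
    obtain ⟨p', rfl⟩ := (P.exact0 _).1 this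
    exact ⟨evAt p', LinearMap.ext fun a => (hp a).symm⟩
  · intro j _ (f : FF Q (P.P (j+1)) →ₗ[EE Q] Q) hf
    obtain ⟨p, hp⟩ := (hR (j+1)).2 f
    have : P.d j p = 0 := (hR j).1 _ fun g => 
      (hp (g ∘ₗ P.d j)).symm.trans (LinearMap.congr_fun hf g)
    obtain ⟨p', rfl⟩ := (P.exact _ _).1 this
    exact ⟨evAt p', LinearMap.ext fun a => (hp a).symm⟩

end FreeRes
end Sub12
end


set_option linter.unusedSectionVars false
set_option linter.unusedVariables false
set_option linter.style.haveILetI false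
noncomputable section
namespace Sub12
open CategoryTheory Paper MulOpposite

theorem PD.four {R : Type} [Ring R] {X Y Z W : Type} [AddCommGroup X] [Module R X]
    [AddCommGroup Y] [Module R Y] [AddCommGroup Z] [Module R Z] [AddCommGroup W] [Module R W]
    {n : ℕ} (f : X →ₗ[R] Y) (g : Y →ₗ[R] Z) (h : Z →ₗ[R] W)
    (hf : Function.Injective f) (hh : Function.Surjective h) (hfg : Function.Exact f g)
    (hgh : Function.Exact g h) (hX : PD R X n) (hY : PD R Y n) (hZ : PD R Z n) :
    PD R W (n+2) := by
  have h1 : PD R (LinearMap.range g) (n+1) := by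
    refine PD.right f g.rangeRestrict hf g.surjective_rangeRestrict ?_ (hY.mono (by omega)) hX
    intro x
    rw [← hfg x]
    exact ⟨fun h => congrArg Subtype.val h, fun h => Subtype.ext h⟩
  refine PD.right (LinearMap.range g).subtype h (Submodule.subtype_injective _) hh ?_
    (hZ.mono (by omega)) h1
  intro x
  rw [hgh x]
  simp

section
variable {k : Type} [Field k] {R S : Type} [Ring R] [Ring S] [Algebra k R] [Algebra k S]
variable (σ : R ≃ₐ[k] Sᵐᵒᵖ)
variable {X Y Z : Type} [AddCommGroup X] [Module k X] [AddCommGroup Y] [Module k Y]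
  [AddCommGroup Z] [Module k Z] [Module S X] [IsScalarTower k S X] [Module S Y]
  [IsScalarTower k S Y] [Module S Z] [IsScalarTower k S Z]

theorem dmap_exact' (f : X →ₗ[S] Y) (g : Y →ₗ[S] Z)
    (h : Function.Exact f g) : Function.Exact (dmap σ g) (dmap σ f) := by
  have h1 : Function.Exact f g.rangeRestrict := by
    intro x
    rw [← h x]
    exact ⟨fun h => congrArg Subtype.val h, fun h => Subtype.ext h⟩
  have h2 := dmap_exact σ f g.rangeRestrict g.surjective_rangeRestrict h1
  intro φ
  rw [h2 φ]
  constructor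
  · rintro ⟨ψ, rfl⟩
    obtain ⟨χ, rfl⟩ := dmap_surj σ (LinearMap.range g).subtype (Submodule.subtype_injective _) ψ
    exact ⟨χ, rfl⟩
  · rintro ⟨ψ, rfl⟩
    exact ⟨dmap σ (LinearMap.range g).subtype ψ, rfl⟩

/-- The dual of an equivalence. -/
def dequiv (e : X ≃ₗ[S] Y) : DD σ Y ≃ₗ[R] DD σ X :=
  LinearEquiv.ofBijective (dmap σ e.toLinearMap)
    ⟨dmap_inj σ _ e.surjective, dmap_surj σ _ e.injective⟩
end

section Theta
variable (k : Type) [Field k] {B : Type} [Ring B] [Algebra k B] (Q : ModuleCat.{0} B)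

/-- Anti-isomorphism used to dualize left `End Q`-modules. -/
def sA : (EE Q)ᵐᵒᵖ ≃ₐ[k] (EE Q)ᵐᵒᵖ := AlgEquiv.refl

variable (B) in
/-- Anti-isomorphism used to dualize left `B`-modules. -/
def sB : Bᵐᵒᵖ ≃ₐ[k] Bᵐᵒᵖ := AlgEquiv.refl

/-- Dual pairs. -/
structure DPair (L R : Type) [AddCommGroup L] [Module B L] [AddCommGroup R] [Module Bᵐᵒᵖ R] where
  /-- the pairing -/
  β : L → R → B
  add_left : ∀ x y u, β (x + y) u = β x u + β y u
  add_right : ∀ x u v, β x (u + v) = β x u + β x v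
  smul_left : ∀ (b : B) x u, β (b • x) u = b * β x u
  smul_right : ∀ (b : B) x u, β x (op b • u) = β x u * b
  /-- size of the dual basis -/
  n : ℕ
  /-- dual basis -/
  e : Fin n → L
  /-- dual basis -/
  u : Fin n → R
  base_left : ∀ x, x = ∑ i, β x (u i) • e i
  base_right : ∀ v, v = ∑ i, op (β (e i) v) • u i

variable {L R : Type} [AddCommGroup L] [Module B L] [AddCommGroup R] [Module Bᵐᵒᵖ R]
  [Module k R] [IsScalarTower k Bᵐᵒᵖ R]

/-- Rank one maps. -/
def DPair.r1 (p : DPair (B := B) L R) (q : Q) (v : R) : FF Q L where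
  toFun x := p.β x v • q
  map_add' x y := by rw [p.add_left, add_smul]
  map_smul' b x := by rw [p.smul_left, mul_smul]; rfl

@[simp] theorem DPair.r1_apply (p : DPair (B := B) L R) (q : Q) (v : R) (x : L) :
    p.r1 Q q v x = p.β x v • q := rfl

theorem DPair.ksmul_right (p : DPair (B := B) L R) (c : k) (x : L) (v : R) :
    p.β x (c • v) = p.β x v * algebraMap k B c := by
  rw [← algebraMap_smul Bᵐᵒᵖ c v]
  exact p.smul_right _ _ _

/-- The natural map. -/
def DPair.theta (p : DPair (B := B) L R) :
    DD (sA k Q) (FF Q L) →ₗ[(EE Q)ᵐᵒᵖ] GG Q (DD (flip (sB k B)) R) where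
  toFun θ :=
    ({ toFun := fun q =>
        ({ toFun := fun v => θ (p.r1 Q q v)
           map_add' := fun v w => by
            rw [← map_add]; congr 1; ext x; simp [p.add_right, add_smul]
           map_smul' := fun c v => by
            rw [RingHom.id_apply, ← map_smul]; congr 1; ext x
            simp only [DPair.r1_apply, p.ksmul_right k, LinearMap.smul_apply]
            rw [← Algebra.commutes, mul_smul, algebraMap_smul] } : R →ₗ[k] k)
       map_add' := fun q q' => dd_ext _ fun v => by
        change θ _ = θ _ + θ _
        rw [← map_add]; congr 1; ext x; simp
       map_smul' := fun b q => dd_ext (flip (sB k B)) fun v => by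
        change θ (p.r1 Q (b • q) v) = θ (p.r1 Q q (op b • v))
        congr 1; ext x; simp [p.smul_right, mul_smul] } : Q →ₗ[B] DD (flip (sB k B)) R)
  map_add' _ _ := rfl
  map_smul' a θ := gg_ext fun q => dd_ext (flip (sB k B)) fun v => by
    change θ (a.unop • p.r1 Q q v) = θ (p.r1 Q (a.unop q) v)
    congr 1; ext x
    exact LinearMap.map_smul a.unop _ _

theorem DPair.theta_apply (p : DPair (B := B) L R) (θ : DD (sA k Q) (FF Q L)) (q : Q) (v : R) :
    p.theta k Q θ q v = θ (p.r1 Q q v) := rfl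

theorem DPair.theta_bij (p : DPair (B := B) L R) : Function.Bijective (p.theta k Q) := by
  constructor
  · rw [injective_iff_map_eq_zero]
    intro θ h
    refine dd_ext _ fun f => ?_
    have hf : f = ∑ i, p.r1 Q (f (p.e i)) (p.u i) := by
      ext x
      conv_lhs => rw [p.base_left x]
      simp
    rw [hf, map_sum]
    refine Finset.sum_eq_zero fun i _ => ?_
    exact DFunLike.congr_fun (DFunLike.congr_fun h (f (p.e i))) (p.u i)
  · intro h
    refine ⟨({ toFun := fun f => ∑ i, h (f (p.e i)) (p.u i)
               map_add' := fun f g => by simp [Finset.sum_add_distrib]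
               map_smul' := fun c f => by
                rw [RingHom.id_apply, Finset.smul_sum]
                refine Finset.sum_congr rfl fun i _ => ?_
                rw [LinearMap.smul_apply, ← algebraMap_smul B c, map_smul, algebraMap_smul]
                rfl } : FF Q L →ₗ[k] k), gg_ext fun q => dd_ext (flip (sB k B)) fun v => ?_⟩
    change ∑ i, h (p.β (p.e i) v • q) (p.u i) = h q v
    conv_rhs => rw [p.base_right v, map_sum]
    refine Finset.sum_congr rfl fun i _ => ?_
    rw [map_smul]; rfl

/-- The natural isomorphism. -/
def DPair.thetaE (p : DPair (B := B) L R) :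
    DD (sA k Q) (FF Q L) ≃ₗ[(EE Q)ᵐᵒᵖ] GG Q (DD (flip (sB k B)) R) :=
  LinearEquiv.ofBijective (p.theta k Q) (p.theta_bij k Q)

theorem DPair.theta_nat {L' R' : Type} [AddCommGroup L'] [Module B L'] [AddCommGroup R']
    [Module Bᵐᵒᵖ R'] [Module k R'] [IsScalarTower k Bᵐᵒᵖ R'] (p : DPair (B := B) L R)
    (p' : DPair (B := B) L' R') (f : L →ₗ[B] L') (g : R' →ₗ[Bᵐᵒᵖ] R)
    (h : ∀ x v, p'.β (f x) v = p.β x (g v)) (θ : DD (sA k Q) (FF Q L)) :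
    p'.theta k Q (dmap (sA k Q) (fmap Q f) θ) = gmap Q (dmap (flip (sB k B)) g) (p.theta k Q θ) := by
  refine gg_ext fun q => dd_ext (flip (sB k B)) fun v => ?_
  change θ (fmap Q f (p'.r1 Q q v)) = θ (p.r1 Q q (g v))
  congr 1
  ext x
  simp [h]

end Theta
end Sub12
end


set_option linter.unusedSectionVars false
set_option linter.unusedVariables false
set_option linter.style.haveILetI false
noncomputable section
namespace Sub12
open CategoryTheory Paper MulOpposite

section
variable {R : Type} [Ring R] {X Y : Type} [AddCommGroup X] [Module R X] [AddCommGroup Y] [Module R Y]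

theorem PD.retract {n : ℕ} (s : X →ₗ[R] Y) (r : Y →ₗ[R] X) (h : r ∘ₗ s = LinearMap.id)
    (hY : PD R Y n) : PD R X n := by
  let ρ : Retract (ModuleCat.of R X) (ModuleCat.of R Y) :=
    ⟨ModuleCat.ofHom s, ModuleCat.ofHom r, by
      rw [← ModuleCat.ofHom_comp, h]; rfl⟩
  exact ρ.hasProjectiveDimensionLT (n+1)

theorem PD.pi {n : ℕ} (hY : PD R Y n) (m : ℕ) : PD R (Fin m → Y) n := by
  induction m with
  | zero =>
    apply PD.of_proj
    infer_instance
  | succ m ih =>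
    let e : (Y × (Fin m → Y)) ≃ₗ[R] (Fin (m+1) → Y) := Fin.consLinearEquiv R (fun _ => Y)
    refine PD.equiv e ?_
    exact (ses (LinearMap.inl R Y (Fin m → Y)) (LinearMap.snd R Y (Fin m → Y))
      LinearMap.inl_injective LinearMap.snd_surjective
      (Function.Exact.inl_snd)).hasProjectiveDimensionLT_X₂ (n+1) hY ih

theorem Ret.pd {n : ℕ} (h : Ret R X Y) (hN : PD R X n) : PD R Y n := by
  obtain ⟨m, s, r, h⟩ := h
  exact PD.retract s r h (hN.pi m)

theorem finite_of_superfluous (f : X →ₗ[R] Y) (hf : (LinearMap.range f).FG)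
    (hs : ∀ K : Submodule R X, K ⊔ LinearMap.ker f = ⊤ → K = ⊤) : Module.Finite R X := by
  have : ∃ K : Submodule R X, K.FG ∧ K.map f = LinearMap.range f := by
    obtain ⟨S, hS⟩ := hf
    have hS' : ∀ y ∈ S, ∃ x, f x = y := fun y hy => by
      have : y ∈ LinearMap.range f := hS ▸ Submodule.subset_span hy
      exact this
    choose! x hx using hS'
    classical
    refine ⟨Submodule.span R (S.image x), ⟨_, rfl⟩, ?_⟩
    rw [Submodule.map_span, ← hS]
    congr 1
    ext y
    constructor
    · rintro ⟨z, hz, rfl⟩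
      obtain ⟨w, hw, rfl⟩ := Finset.mem_image.1 hz
      rw [hx w hw]; exact hw
    · intro hy
      exact ⟨x y, Finset.mem_image_of_mem x hy, hx y hy⟩
  obtain ⟨K, hK, hKf⟩ := this
  refine ⟨?_⟩
  rw [← hs K]
  · exact hK
  · rw [← Submodule.comap_map_eq, hKf]
    ext x; simp
end

section
variable {k : Type} [Field k] {R S : Type} [Ring R] [Ring S] [Algebra k R] [Algebra k S]
variable (σ : R ≃ₐ[k] Sᵐᵒᵖ)
variable {X Y : Type} [AddCommGroup X] [Module k X] [AddCommGroup Y] [Module k Y]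
  [Module S X] [IsScalarTower k S X] [Module S Y] [IsScalarTower k S Y]

theorem Ret.dd (h : Ret S X Y) : Ret R (DD σ X) (DD σ Y) := by
  obtain ⟨n, s, r, h⟩ := h
  refine ⟨n, LinearMap.pi fun i => dmap σ (r ∘ₗ LinearMap.single S (fun _ => X) i),
    ∑ i, dmap σ (LinearMap.proj i ∘ₗ s) ∘ₗ LinearMap.proj i, ?_⟩
  refine LinearMap.ext fun φ => dd_ext σ fun y => ?_
  have h' : r (s y) = y := LinearMap.congr_fun h y
  have hsum : ∀ (g : Fin n → DD σ Y), (∑ i, g i) y = ∑ i, g i y := by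
    intro g
    exact LinearMap.sum_apply Finset.univ (fun i => (g i : Y →ₗ[k] k)) y
  simp only [LinearMap.comp_apply, LinearMap.sum_apply, LinearMap.proj_apply, LinearMap.pi_apply,
    LinearMap.id_apply, hsum]
  conv_rhs => rw [← h', ← sum_sgl (R := S) (s y)]
  simp
end

section Tau
variable (k : Type) [Field k] {B : Type} [Ring B] [Algebra k B] (Q : ModuleCat.{0} B)

theorem DPair.ret {L R : Type} [AddCommGroup L] [Module B L] [AddCommGroup R] [Module Bᵐᵒᵖ R]
    (p : DPair (B := B) L R) : Ret B B L := by
  refine ⟨p.n, LinearMap.pi fun i =>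
    { toFun := fun x => p.β x (p.u i)
      map_add' := fun x y => p.add_left _ _ _
      map_smul' := fun b x => p.smul_left _ _ _ },
    ∑ i, LinearMap.toSpanSingleton B L (p.e i) ∘ₗ LinearMap.proj i, ?_⟩
  ext x
  conv_rhs => rw [LinearMap.id_apply, p.base_left x]
  simp

/-- The standard dual pair of a projective left module. -/
theorem exists_dpair_left (P : ModuleCat.{0} B) [Module.Finite B P] (hP : Module.Projective B P) :
    ∃ p : DPair (B := B) P (P →ₗ[B] B), ∀ x u, p.β x u = u x := by
  obtain ⟨n, s, r, h⟩ := Ret.of_proj hP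
  have hx : ∀ x, x = ∑ i, s x i • r (LinearMap.single B (fun _ => B) i 1) := by
    intro x
    have h' : r (s x) = x := LinearMap.congr_fun h x
    conv_lhs => rw [← h', ← sum_sgl (R := B) (s x), map_sum]
    refine Finset.sum_congr rfl fun i _ => ?_
    rw [← map_smul, ← map_smul, smul_eq_mul, mul_one]
  refine ⟨{ β := fun x u => u x
            add_left := fun x y u => map_add u x y
            add_right := fun x u v => rfl
            smul_left := fun b x u => map_smul u b x
            smul_right := fun b x u => rfl
            n := n
            e := fun i => r (LinearMap.single B (fun _ => B) i 1)
            u := fun i => LinearMap.proj i ∘ₗ s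
            base_left := hx
            base_right := fun v => ?_ }, fun _ _ => rfl⟩
  ext x
  conv_lhs => rw [hx x]
  rw [map_sum, LinearMap.sum_apply]
  exact Finset.sum_congr rfl fun i _ => map_smul v _ _

/-- The dual of a right module, as a left module. -/
abbrev star (P : ModuleCat.{0} Bᵐᵒᵖ) : ModuleCat.{0} B :=
  (ModuleCat.restrictScalars (opOpHom B)).obj (ModuleCat.of Bᵐᵒᵖᵐᵒᵖ (P →ₗ[Bᵐᵒᵖ] Bᵐᵒᵖ))

/-- Underlying map of an element. -/
def star.un {P : ModuleCat.{0} Bᵐᵒᵖ} (x : star P) : P →ₗ[Bᵐᵒᵖ] Bᵐᵒᵖ := x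

/-- The standard dual pair of a projective right module. -/
theorem exists_dpair_right (P : ModuleCat.{0} Bᵐᵒᵖ) [Module.Finite Bᵐᵒᵖ P]
    (hP : Module.Projective Bᵐᵒᵖ P) :
    ∃ p : DPair (B := B) (star P) P, ∀ x u, p.β x u = unop (star.un x u) := by
  obtain ⟨n, s, r, h⟩ := Ret.of_proj hP
  have hx : ∀ x, x = ∑ i, s x i • r (LinearMap.single Bᵐᵒᵖ (fun _ => Bᵐᵒᵖ) i 1) := by
    intro x
    have h' : r (s x) = x := LinearMap.congr_fun h x
    conv_lhs => rw [← h', ← sum_sgl (R := Bᵐᵒᵖ) (s x), map_sum]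
    refine Finset.sum_congr rfl fun i _ => ?_
    rw [← map_smul, ← map_smul, smul_eq_mul, mul_one]
  refine ⟨{ β := fun x u => unop (star.un x u)
            add_left := fun x y u => rfl
            add_right := fun x u v => by rw [map_add]; rfl
            smul_left := fun b x u => rfl
            smul_right := fun b x u => by rw [map_smul]; rfl
            n := n
            e := fun i => (LinearMap.proj i ∘ₗ s : P →ₗ[Bᵐᵒᵖ] Bᵐᵒᵖ)
            u := fun i => r (LinearMap.single Bᵐᵒᵖ (fun _ => Bᵐᵒᵖ) i 1)
            base_left := fun v => ?_
            base_right := hx }, fun _ _ => rfl⟩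
  let w : P →ₗ[Bᵐᵒᵖ] Bᵐᵒᵖ := v
  have key : w = ∑ i, (op (w (r (LinearMap.single Bᵐᵒᵖ (fun _ => Bᵐᵒᵖ) i 1)))) •
      (LinearMap.proj i ∘ₗ s : P →ₗ[Bᵐᵒᵖ] Bᵐᵒᵖ) := by
    ext1 x
    conv_lhs => rw [hx x]
    rw [map_sum, LinearMap.sum_apply]
    exact Finset.sum_congr rfl fun i _ => map_smul w _ _
  exact key

variable [FiniteDimensional k B] {Q}

theorem noeth (k : Type) [Field k] (B : Type) [Ring B] [Algebra k B] [FiniteDimensional k B] :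
    IsNoetherianRing B := isNoetherian_of_tower k inferInstance

theorem pd_dd_ff {m : ℕ} (hQ : PD (EE Q)ᵐᵒᵖ (DD (sA k Q) Q) m) {P : Type} [AddCommGroup P]
    [Module B P] (hP : Ret B B P) : PD (EE Q)ᵐᵒᵖ (DD (sA k Q) (FF Q P)) m :=
  Ret.pd (Ret.dd (sA k Q) (Ret.of_equiv_left (ffB Q) (Ret.ff Q hP))) hQ

theorem id_dd_ff {m : ℕ} (hQ : PD (EE Q) Q m) {P : Type} [AddCommGroup P]
    [Module B P] (hP : Ret B B P) : ID (EE Q)ᵐᵒᵖ (DD (sA k Q) (FF Q P)) m :=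
  Ret.id (Ret.dd (sA k Q) (Ret.of_equiv_left (ffB Q) (Ret.ff Q hP))) (id_dd (sA k Q) m _ hQ)

variable (B) in
/-- Comparison of the two duals. -/
def dunopE (Y : ModuleCat.{0} Bᵐᵒᵖ) : Dunop k B Y ≃ₗ[B] DD (flip (sB k B)) Y where
  toFun φ := (φ : Y →ₗ[k] k)
  map_add' _ _ := rfl
  map_smul' _ _ := rfl
  invFun φ := (φ : Y →ₗ[k] k)
  left_inv _ := rfl
  right_inv _ := rfl

variable (B) in
/-- Comparison of the two duals. -/
def dopE (Y : ModuleCat.{0} B) : Dop k B Y ≃ₗ[Bᵐᵒᵖ] DD (sB k B) Y where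
  toFun φ := (φ : Y →ₗ[k] k)
  map_add' _ _ := rfl
  map_smul' _ _ := rfl
  invFun φ := (φ : Y →ₗ[k] k)
  left_inv _ := rfl
  right_inv _ := rfl

theorem tau_pd {m : ℕ} {Z T : ModuleCat.{0} B} [Module.Finite B Z] (hT : IsTauOf k B Z T)
    (hG : PD (EE Q)ᵐᵒᵖ (GG Q T) m) (hQ : PD (EE Q)ᵐᵒᵖ (DD (sA k Q) Q) m) :
    PD (EE Q)ᵐᵒᵖ (DD (sA k Q) (FF Q Z)) (m+2) := by
  haveI : IsNoetherianRing B := noeth k B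
  obtain ⟨Tr, ⟨P1, P0, g, p, ⟨hP0, hp, hps⟩, hP1, hgp, hgs, ⟨e⟩⟩, ⟨eT⟩⟩ := hT
  haveI : Module.Finite B P0 := finite_of_superfluous p (IsNoetherian.noetherian _) hps
  haveI : Module.Finite B P1 := finite_of_superfluous g (IsNoetherian.noetherian _) hgs
  obtain ⟨p0, hp0⟩ := exists_dpair_left P0 hP0
  obtain ⟨p1, hp1⟩ := exists_dpair_left P1 hP1
  let N := LinearMap.range (lprecomp B g)
  let eT' : T ≃ₗ[B] DD (flip (sB k B)) ((P1 →ₗ[B] B) ⧸ N) :=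
    (eT.trans (dunopE k B Tr)).trans (dequiv (flip (sB k B)) e.symm)
  let j : T →ₗ[B] DD (flip (sB k B)) (P1 →ₗ[B] B) := dmap (flip (sB k B)) N.mkQ ∘ₗ eT'.toLinearMap
  have hj : Function.Injective j :=
    (dmap_inj (flip (sB k B)) N.mkQ (Submodule.mkQ_surjective _)).comp eT'.injective
  have hje : Function.Exact j (dmap (flip (sB k B)) (lprecomp B g)) := by
    intro φ
    rw [dmap_exact (flip (sB k B)) (lprecomp B g) N.mkQ (Submodule.mkQ_surjective _)
      (lprecomp B g).exact_map_mkQ_range φ]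
    constructor
    · rintro ⟨ψ, rfl⟩
      exact ⟨eT'.symm ψ, by simp [j]⟩
    · rintro ⟨ψ, rfl⟩
      exact ⟨eT' ψ, rfl⟩
  have hge := gmap_exact Q j (dmap (flip (sB k B)) (lprecomp B g)) hj hje
  refine PD.four ((p1.thetaE k Q).symm.toLinearMap ∘ₗ gmap Q j) (dmap (sA k Q) (fmap Q g))
    (dmap (sA k Q) (fmap Q p)) ?_ ?_ ?_ ?_ hG (pd_dd_ff k hQ (Ret.of_proj hP1))
    (pd_dd_ff k hQ (Ret.of_proj hP0))
  · exact (p1.thetaE k Q).symm.injective.comp (gmap_inj Q j hj)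
  · exact dmap_surj _ _ (fmap_inj Q p hp)
  · intro θ
    rw [← map_eq_zero_iff (p0.theta k Q) (p0.theta_bij k Q).1,
      p1.theta_nat k Q p0 g (lprecomp B g) (fun x v => by rw [hp0, hp1]; rfl), hge]
    constructor
    · rintro ⟨h, hh⟩
      exact ⟨h, by
        rw [LinearMap.comp_apply, hh]
        exact (p1.thetaE k Q).symm_apply_apply θ⟩
    · rintro ⟨h, rfl⟩
      refine ⟨h, ?_⟩
      exact ((p1.thetaE k Q).apply_symm_apply _).symm
  · exact dmap_exact' _ _ _ (fmap_exact Q g p hp hgp)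

theorem tauInv_id {r : ℕ} {Z T : ModuleCat.{0} B} [Module.Finite B Z] (hT : IsTauInvOf k B Z T)
    (hF : PD (EE Q) (FF Q T) r) (hQ : PD (EE Q) Q r) :
    ID (EE Q)ᵐᵒᵖ (GG Q Z) (r+2) := by
  haveI : IsNoetherianRing Bᵐᵒᵖ := noeth k Bᵐᵒᵖ
  haveI : FiniteDimensional k Z := Module.Finite.trans B Z
  haveI : Module.Finite Bᵐᵒᵖ (Dop k B Z) :=
    haveI : Module.Finite Bᵐᵒᵖ (DD (sB k B) Z) := Module.Finite.of_restrictScalars_finite k _ _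
    Module.Finite.equiv (dopE k B Z).symm
  obtain ⟨Tr, ⟨P1, P0, g, p, ⟨hP0, hp, hps⟩, hP1, hgp, hgs, ⟨e⟩⟩, ⟨eT⟩⟩ := hT
  haveI : Module.Finite Bᵐᵒᵖ P0 := finite_of_superfluous p (IsNoetherian.noetherian _) hps
  haveI : Module.Finite Bᵐᵒᵖ P1 := finite_of_superfluous g (IsNoetherian.noetherian _) hgs
  obtain ⟨p0, hp0⟩ := exists_dpair_right P0 hP0
  obtain ⟨p1, hp1⟩ := exists_dpair_right P1 hP1
  let lp : star P0 →ₗ[B] star P1 :=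
    { toFun := lprecomp Bᵐᵒᵖ g
      map_add' := fun _ _ => rfl
      map_smul' := fun _ _ => rfl }
  let N := LinearMap.range (lprecomp Bᵐᵒᵖ g)
  let c : star P1 →ₗ[B] T :=
    { toFun := fun x => eT.symm (e.symm (N.mkQ (star.un x)))
      map_add' := fun x y => by
        change eT.symm (e.symm (N.mkQ (star.un x + star.un y))) = _
        rw [map_add, map_add]
        exact map_add eT.symm _ _
      map_smul' := fun b x => by
        change eT.symm (e.symm (N.mkQ (op (op b) • star.un x))) = _
        rw [map_smul, map_smul]
        exact map_smul eT.symm b _ }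
  have hc : Function.Surjective c :=
    eT.symm.surjective.comp (e.symm.surjective.comp (Submodule.mkQ_surjective N))
  have hlc : Function.Exact lp c := by
    intro x
    refine Iff.trans ?_ ((lprecomp Bᵐᵒᵖ g).exact_map_mkQ_range (star.un x))
    change eT.symm (e.symm (N.mkQ (star.un x))) = 0 ↔ N.mkQ (star.un x) = 0
    refine (map_eq_zero_iff eT.symm eT.symm.injective).trans ?_
    exact map_eq_zero_iff e.symm e.symm.injective
  let bd : Z ≃ₗ[B] DD (flip (sB k B)) (Dop k B Z) :=
    (evalDD (sB k B)).trans (dequiv (flip (sB k B)) (dopE k B Z))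
  let j : Z →ₗ[B] DD (flip (sB k B)) P0 := dmap (flip (sB k B)) p ∘ₗ bd.toLinearMap
  have hj : Function.Injective j :=
    (dmap_inj (flip (sB k B)) p hp).comp bd.injective
  have hje : Function.Exact j (dmap (flip (sB k B)) g) := by
    intro φ
    rw [dmap_exact (flip (sB k B)) g p hp hgp φ]
    constructor
    · rintro ⟨ψ, rfl⟩
      exact ⟨bd.symm ψ, by simp [j]⟩
    · rintro ⟨ψ, rfl⟩
      exact ⟨bd ψ, rfl⟩
  have hge := gmap_exact Q j (dmap (flip (sB k B)) g) hj hje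
  refine ID.four ((p0.thetaE k Q).symm.toLinearMap ∘ₗ gmap Q j) (dmap (sA k Q) (fmap Q lp))
    (dmap (sA k Q) (fmap Q c)) ?_ ?_ ?_ ?_ (id_dd_ff k hQ p0.ret)
    (id_dd_ff k hQ p1.ret) (id_dd (sA k Q) r _ hF)
  · exact (p0.thetaE k Q).symm.injective.comp (gmap_inj Q j hj)
  · exact dmap_surj _ _ (fmap_inj Q c hc)
  · intro θ
    rw [← map_eq_zero_iff (p1.theta k Q) (p1.theta_bij k Q).1,
      p0.theta_nat k Q p1 lp g (fun x v => by rw [hp0, hp1]; rfl), hge]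
    constructor
    · rintro ⟨h, hh⟩
      exact ⟨h, by
        rw [LinearMap.comp_apply, hh]
        exact (p0.thetaE k Q).symm_apply_apply θ⟩
    · rintro ⟨h, rfl⟩
      refine ⟨h, ?_⟩
      exact ((p0.thetaE k Q).apply_symm_apply _).symm
  · exact dmap_exact' _ _ _ (fmap_exact Q lp c hc hlc)

end Tau
end Sub12
end


set_option linter.unusedSectionVars false
set_option linter.unusedVariables false
set_option linter.style.haveILetI false
noncomputable section
namespace Sub12
open CategoryTheory Paper MulOpposite

section Final
variable (k : Type) [Field k] {B : Type} [Ring B] [Algebra k B] {Q : ModuleCat.{0} B}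

/-- `FF` on equivalences. -/
def ffE {X Y : Type} [AddCommGroup X] [Module B X] [AddCommGroup Y] [Module B Y] (e : X ≃ₗ[B] Y) :
    FF Q Y ≃ₗ[EE Q] FF Q X :=
  LinearEquiv.ofBijective (fmap Q e.toLinearMap) ⟨fmap_inj Q _ e.surjective, fun f =>
    ⟨f ∘ₗ e.symm.toLinearMap, by ext x; simp⟩⟩

/-- `GG` on equivalences. -/
def ggE {X Y : Type} [AddCommGroup X] [Module B X] [AddCommGroup Y] [Module B Y] (e : X ≃ₗ[B] Y) :
    GG Q X ≃ₗ[(EE Q)ᵐᵒᵖ] GG Q Y :=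
  LinearEquiv.ofBijective (gmap Q e.toLinearMap) ⟨gmap_inj Q _ e.injective, fun f =>
    ⟨gmap Q e.symm.toLinearMap f, gg_ext fun q => by simp⟩⟩

/-- The regular dual pair. -/
def regPair : DPair (B := B) B Bᵐᵒᵖ where
  β x u := x * unop u
  add_left x y u := add_mul _ _ _
  add_right x u v := mul_add _ _ _
  smul_left b x u := mul_assoc _ _ _
  smul_right b x u := (mul_assoc _ _ _).symm
  n := 1
  e _ := 1
  u _ := 1
  base_left x := by simp
  base_right v := by simp

variable (B) in
/-- The right regular module. -/
def opE : (ModuleCat.of Bᵐᵒᵖ B) ≃ₗ[Bᵐᵒᵖ] Bᵐᵒᵖ where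
  toFun b := op (b : B)
  map_add' _ _ := rfl
  map_smul' _ _ := rfl
  invFun b := (unop b : B)
  left_inv _ := rfl
  right_inv _ := rfl

variable (Q) in
/-- `Hom(Q, DB) = DQ`. -/
def ggD : GG Q (DD (flip (sB k B)) Bᵐᵒᵖ) ≃ₗ[(EE Q)ᵐᵒᵖ] DD (sA k Q) Q :=
  (regPair.thetaE k Q).symm.trans (dequiv (sA k Q) (ffB Q).symm)

/-- `D` of an equivalence, bundled source. -/
def dequivM (Y : ModuleCat.{0} Bᵐᵒᵖ) (e : Y ≃ₗ[Bᵐᵒᵖ] Bᵐᵒᵖ) :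
    DD (flip (sB k B)) Y ≃ₗ[B] DD (flip (sB k B)) Bᵐᵒᵖ := dequiv (flip (sB k B)) e.symm

variable (B) in
/-- `DB` in two versions. -/
def dcogenE : Dcogen k B ≃ₗ[B] DD (flip (sB k B)) Bᵐᵒᵖ :=
  (dunopE k B (ModuleCat.of Bᵐᵒᵖ B)).trans (dequivM k (ModuleCat.of Bᵐᵒᵖ B) (opE B))

theorem pd_dq {m : ℕ} (h : QuasiCogenLE k B Q m) : PD (EE Q)ᵐᵒᵖ (DD (sA k Q) Q) m :=
  PD.equiv ((ggE (dcogenE k B)).trans (ggD k Q)) (pd_of_res h)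

theorem pd_q {l : ℕ} (h : QuasiGenLE B Q l) : PD (EE Q) Q l :=
  PD.equiv (ffB Q) (pd_of_cores h)

variable [FiniteDimensional k B]

theorem omega_fin (k : Type) [Field k] {B : Type} [Ring B] [Algebra k B] [FiniteDimensional k B] (t : ℕ) : ∀ (X Z : ModuleCat.{0} B), Module.Finite B X → IsOmegaOf B t X Z →
    Module.Finite B Z := by
  haveI : IsNoetherianRing B := noeth k B
  induction t with
  | zero =>
    rintro X Z hX ⟨e⟩
    exact Module.Finite.equiv e.symm
  | succ t ih =>
    rintro X Z hX ⟨Y, ⟨P, p, ⟨hP, hp, hps⟩, ⟨e⟩⟩, h⟩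
    haveI : Module.Finite B P := finite_of_superfluous p (IsNoetherian.noetherian _) hps
    exact ih Y Z (Module.Finite.equiv e.symm) h

theorem omega_pd {m s : ℕ} (hQ : PD (EE Q)ᵐᵒᵖ (DD (sA k Q) Q) m) (hms : m ≤ s) (t : ℕ) :
    ∀ (X Z : ModuleCat.{0} B), Module.Finite B X → IsOmegaOf B t X Z →
    (∀ i, 1 ≤ i → i ≤ t → EV B X Q i) → PD (EE Q)ᵐᵒᵖ (DD (sA k Q) (FF Q Z)) s →
    PD (EE Q)ᵐᵒᵖ (DD (sA k Q) (FF Q X)) (s+t) := by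
  haveI : IsNoetherianRing B := noeth k B
  induction t with
  | zero =>
    rintro X Z hX ⟨e⟩ _ h
    exact PD.equiv (dequiv (sA k Q) (ffE e)) h
  | succ t ih =>
    rintro X Z hX ⟨Y, ⟨P, p, ⟨hP, hp, hps⟩, ⟨e⟩⟩, hZ⟩ hE h
    haveI : Module.Finite B P := finite_of_superfluous p (IsNoetherian.noetherian _) hps
    let f : Y →ₗ[B] P := (LinearMap.ker p).subtype ∘ₗ e.toLinearMap
    have hf : Function.Injective f := (Submodule.subtype_injective _).comp e.injective
    have hfp : Function.Exact f p := by
      intro x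
      rw [p.exact_subtype_ker_map x]
      constructor
      · rintro ⟨y, rfl⟩
        exact ⟨e.symm y, by simp [f]⟩
      · rintro ⟨y, rfl⟩
        exact ⟨e y, rfl⟩
    have hY := ih Y Z (Module.Finite.equiv e.symm) hZ (fun i h1 h2 => by
      obtain ⟨i, rfl⟩ : ∃ i', i = i' + 1 := ⟨i - 1, by omega⟩
      exact (ev_shift_iff f p hf hp hfp hP i).1 (hE (i+2) (by omega) (by omega))) h
    have hs : Function.Surjective (fmap Q f) :=
      (ev_one_iff f p hf hp hfp hP).1 (hE 1 le_rfl (by omega))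
    exact PD.right (dmap (sA k Q) (fmap Q f)) (dmap (sA k Q) (fmap Q p)) (dmap_inj _ _ hs)
      (dmap_surj _ _ (fmap_inj Q p hp)) (dmap_exact' _ _ _ (fmap_exact Q f p hp hfp))
      ((pd_dd_ff k hQ (Ret.of_proj hP)).mono (show m ≤ s + t + 1 by omega)) hY

theorem env_ret {X I : ModuleCat.{0} B} [Module.Finite B X] (ι : X →ₗ[B] I)
    (h : IsInjEnvelope B ι) :
    Ret B (DD (flip (sB k B)) Bᵐᵒᵖ) I ∧ Module.Finite B I := by
  obtain ⟨hI, hι, he⟩ := h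
  haveI : FiniteDimensional k X := Module.Finite.trans B X
  haveI : Module.Finite Bᵐᵒᵖ (DD (sB k B) X) := Module.Finite.of_restrictScalars_finite k _ _
  obtain ⟨n, p, hp⟩ := Module.Finite.exists_fin' Bᵐᵒᵖ (DD (sB k B) X)
  let j : X →ₗ[B] DD (flip (sB k B)) (Fin n → Bᵐᵒᵖ) :=
    dmap (flip (sB k B)) p ∘ₗ (evalDD (sB k B)).toLinearMap
  have hj : Function.Injective j := (dmap_inj (flip (sB k B)) p hp).comp (evalDD (sB k B)).injective
  have hJ : Module.Injective B (DD (flip (sB k B)) (Fin n → Bᵐᵒᵖ)) := dd_injective _ inferInstance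
  obtain ⟨h, hh⟩ := hJ.out ι hι j
  have hinj : Function.Injective h := by
    rw [← LinearMap.ker_eq_bot]
    apply he
    rw [eq_bot_iff]
    rintro _ ⟨hx, ⟨y, rfl⟩⟩
    have : j y = 0 := (hh y).symm.trans hx
    rw [hj (this.trans (map_zero j).symm)]
    simp
  obtain ⟨r, hr⟩ := hI.out h hinj LinearMap.id
  constructor
  · obtain ⟨m, s', r', hsr⟩ := Ret.dd (flip (sB k B)) (Ret.pow (R := Bᵐᵒᵖ) (M := Bᵐᵒᵖ) n)
    refine ⟨m, s' ∘ₗ h, r ∘ₗ r', ?_⟩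
    ext x
    have := LinearMap.congr_fun hsr (h x)
    simp only [LinearMap.comp_apply, LinearMap.id_apply] at this ⊢
    rw [this]
    exact hr x
  · haveI : Module.Finite B (DD (flip (sB k B)) (Fin n → Bᵐᵒᵖ)) :=
      Module.Finite.of_restrictScalars_finite k _ _
    exact Module.Finite.of_surjective r (fun x => ⟨h x, hr x⟩)

theorem omegaInv_fin (k : Type) [Field k] {B : Type} [Ring B] [Algebra k B] [FiniteDimensional k B]
    (t : ℕ) : ∀ (X Z : ModuleCat.{0} B), Module.Finite B X →
    IsOmegaInvOf B t X Z → Module.Finite B Z := by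
  induction t with
  | zero =>
    rintro X Z hX ⟨e⟩
    exact Module.Finite.equiv e.symm
  | succ t ih =>
    rintro X Z hX ⟨Y, ⟨I, ι, hι, ⟨e⟩⟩, h⟩
    haveI := (env_ret k ι hι).2
    exact ih Y Z (Module.Finite.equiv e.symm) h

theorem omegaInv_id (k : Type) [Field k] {B : Type} [Ring B] [Algebra k B] [FiniteDimensional k B]
    {Q : ModuleCat.{0} B} {l s : ℕ} (hQ : PD (EE Q) Q l) (hls : l ≤ s) (t : ℕ) :
    ∀ (X Z : ModuleCat.{0} B), Module.Finite B X → IsOmegaInvOf B t X Z →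
    (∀ i, 1 ≤ i → i ≤ t → EV B Q X i) → ID (EE Q)ᵐᵒᵖ (GG Q Z) s →
    ID (EE Q)ᵐᵒᵖ (GG Q X) (s+t) := by
  induction t with
  | zero =>
    rintro X Z hX ⟨e⟩ _ h
    exact ID.equiv (ggE e) h
  | succ t ih =>
    rintro X Z hX ⟨Y, ⟨I, ι, hιe, ⟨e⟩⟩, hZ⟩ hE h
    obtain ⟨hR, hfin⟩ := env_ret k ι hιe
    obtain ⟨hI, hι, he⟩ := hιe
    let g : I →ₗ[B] Y := e.symm.toLinearMap ∘ₗ (LinearMap.range ι).mkQ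
    have hg : Function.Surjective g := e.symm.surjective.comp (Submodule.mkQ_surjective _)
    have hιg : Function.Exact ι g := by
      intro x
      rw [← ι.exact_map_mkQ_range x]
      exact map_eq_zero_iff e.symm e.symm.injective
    have hY := ih Y Z (Module.Finite.equiv e.symm) hZ (fun i h1 h2 => by
      obtain ⟨i, rfl⟩ : ∃ i', i = i' + 1 := ⟨i - 1, by omega⟩
      exact ev_cov_shift ι g hι hg hιg hI i (hE (i+2) (by omega) (by omega))) h
    have hs : Function.Surjective (gmap Q g) := fun u =>
      ev_cov_one ι g hι hg hιg (hE 1 le_rfl (by omega)) u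
    have hGI : ID (EE Q)ᵐᵒᵖ (GG Q I) l :=
      Ret.id (Ret.gg Q hR) (ID.equiv (ggD k Q).symm (id_dd (sA k Q) l _ hQ))
    exact ID.left (gmap Q ι) (gmap Q g) (gmap_inj Q ι hι) hs (gmap_exact Q ι g hι hιg)
      (hGI.mono (show l ≤ s + t + 1 by omega)) hY

theorem final [Module.Finite B Q] (n m l : ℕ)
    (hn : l ≤ n) (hn' : m + 2 ≤ n)
    (h1 : ∀ i, 1 ≤ i → i ≤ n - 2 → ExtVanish B Q Q i)
    (h2 : IsQuasiGen B Q l)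
    (h3 : IsQuasiCogen k B Q m)
    (h4 : ∃ T, IsTauN k B (n - m - 1) Q T ∧ RelAddDimLE B Q T m)
    (h5 : ∃ i, 1 ≤ i ∧ i ≤ n - 1 ∧
      ∃ T, IsTauInvN k B i Q T ∧ ∃ r, RelAddCodimLE B Q T r) :
    IsRelAGPair (Module.End B Q) (ModuleCat.of (Module.End B Q) Q) n ∧
    idDim (Module.End B Q) (ModuleCat.of (Module.End B Q) (Module.End B Q)) =
      idDim (Module.End B Q)ᵐᵒᵖ
        (ModuleCat.of (Module.End B Q)ᵐᵒᵖ (Module.End B Q)ᵐᵒᵖ) := by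
  haveI : IsNoetherianRing B := noeth k B
  haveI : FiniteDimensional k Q := Module.Finite.trans B Q
  haveI hAfin : FiniteDimensional k (EE Q) :=
    FiniteDimensional.of_injective (LinearMap.restrictScalarsₗ k B Q Q k)
      (LinearMap.restrictScalars_injective k)
  have hDQ := pd_dq k h3.1
  have hQ := pd_q h2.1
  have hEV : ∀ i, 1 ≤ i → i ≤ n - 2 → EV B Q Q i := ev_of_vanish (n-2) h1
  have hleft : ID (EE Q) (EE Q) n := by
    obtain ⟨T, ⟨Z, hZ, hT⟩, hres⟩ := h4
    haveI := omega_fin k _ Q Z inferInstance hZ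
    have e1 := tau_pd k hT (pd_of_res hres) hDQ
    have e2 := omega_pd k hDQ (by omega : m ≤ m + 2) _ Q Z inferInstance hZ
      (fun i hi hi' => hEV i hi (by omega)) e1
    have e3 := id_dd (flip (sA k Q)) _ _ e2
    have e4 : ID (EE Q) (FF Q Q) _ := ID.equiv (evalDD (sA k Q)).symm e3
    have e5 : ID (EE Q) (FF Q Q) n := e4.mono (by omega)
    exact e5
  have hright : ∃ s, ID (EE Q)ᵐᵒᵖ (EE Q)ᵐᵒᵖ s := by
    obtain ⟨i, hi, hi', T, ⟨Z, hZ, hT⟩, r, hres⟩ := h5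
    haveI := omegaInv_fin k _ Q Z inferInstance hZ
    have hFT : PD (EE Q) (FF Q T) (max r l) := (pd_of_cores hres).mono (le_max_left _ _)
    have hQ' : PD (EE Q) Q (max r l) := hQ.mono (le_max_right _ _)
    have e1 := tauInv_id k hT hFT hQ'
    have e2 := omegaInv_id k hQ' (by omega) _ Q Z inferInstance hZ
      (fun i hi hi' => hEV i hi (by omega)) e1
    exact ⟨_, ID.equiv (ggQ Q) e2⟩
  obtain ⟨s, hs⟩ := hright
  have hiff : ∀ j, ID (EE Q) (EE Q) j ↔ ID (EE Q)ᵐᵒᵖ (EE Q)ᵐᵒᵖ j := fun j =>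
    ⟨fun h => zaks (sA k Q) h hs, fun h => zaks (flip (sA k Q)) h hleft⟩
  refine ⟨⟨idLE_iff.2 hleft, idLE_iff.2 ((hiff n).1 hleft), selfOrth h2.1,
    domdim h1 (Refl.cores h2.1)⟩, ?_⟩
  unfold idDim
  congr 1
  ext c
  constructor
  · rintro ⟨j, rfl, hj⟩
    exact ⟨j, rfl, idLE_iff.2 ((hiff j).1 (idLE_iff.1 hj))⟩
  · rintro ⟨j, rfl, hj⟩
    exact ⟨j, rfl, idLE_iff.2 ((hiff j).2 (idLE_iff.1 hj))⟩

end Final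
end Sub12
end

noncomputable section Statement12
open Paper

/-- Proposition 3.10: if `Q` is a right `Λ`-module (i.e. a left
`Λᵐᵒᵖ`-module) satisfying conditions (i)–(v), and `A = End_Λ(Q)`, with
`n ≥ max(l, m + 2)`, then `(A, Q)` is a relative `n`-Auslander–Gorenstein pair; in
particular `A` is Iwanaga–Gorenstein with `id(_A A) = id(A_A) ≤ n` and
`Q`-domdim of `A` at least `n`. -/
theorem stmt12 (k : Type) [Field k] (Λ : Type) [Ring Λ] [Algebra k Λ]
    [FiniteDimensional k Λ]
    (Q : ModuleCat.{0} Λᵐᵒᵖ) [Module.Finite Λᵐᵒᵖ Q] (n m l : ℕ)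
    (hn : l ≤ n) (hn' : m + 2 ≤ n)
    (h1 : ∀ i, 1 ≤ i → i ≤ n - 2 → ExtVanish Λᵐᵒᵖ Q Q i)
    (h2 : IsQuasiGen Λᵐᵒᵖ Q l)
    (h3 : IsQuasiCogen k Λᵐᵒᵖ Q m)
    (h4 : ∃ T, IsTauN k Λᵐᵒᵖ (n - m - 1) Q T ∧ RelAddDimLE Λᵐᵒᵖ Q T m)
    (h5 : ∃ i, 1 ≤ i ∧ i ≤ n - 1 ∧
      ∃ T, IsTauInvN k Λᵐᵒᵖ i Q T ∧ ∃ r, RelAddCodimLE Λᵐᵒᵖ Q T r) :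
    IsRelAGPair (Module.End Λᵐᵒᵖ Q) (ModuleCat.of (Module.End Λᵐᵒᵖ Q) Q) n ∧
    idDim (Module.End Λᵐᵒᵖ Q) (ModuleCat.of (Module.End Λᵐᵒᵖ Q) (Module.End Λᵐᵒᵖ Q)) =
      idDim (Module.End Λᵐᵒᵖ Q)ᵐᵒᵖ
        (ModuleCat.of (Module.End Λᵐᵒᵖ Q)ᵐᵒᵖ (Module.End Λᵐᵒᵖ Q)ᵐᵒᵖ) := by
  exact Sub12.final k n m l hn hn' h1 h2 h3 h4 h5

end Statement12
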